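/- arXiv:2004.07396 — 2 statements merged into one kernel-verified Lean document; each statement's English description precedes it below -/
import Mathlib

section
/- Let m>0 and 0<δ<1/2. For every ε>0 there exist x>0 and C>0 such that the following holds: let U ∈ (0,∞], let h be a C¹ function on [0,U]×[0,∞) with ‖∂_r h‖_{L^∞_U L^{∞,2-δ}_r} < x, let 0 ≤ u₁ ≤ U and r₁ ≥ 0, and let r(·) be the characteristic of h through (u₁,r₁), defined and nonnegative on [0,u₁]. Then for all 0 ≤ u ≤ u₁ one has exp( m ∫_u^{u₁} G(s, r(s)) ds ) ≤ C · ((1+r(u))/(1+r₁))^{2m-ε}, where G=G[h]. -/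
open Set MeasureTheory Real Filter

/-- Radial average: `w̄(r) = (1/r)∫₀ʳ w(s) ds` for `r ≠ 0`, with `w̄(0) = w(0)`. -/
noncomputable def radAvg (w : ℝ → ℝ) (r : ℝ) : ℝ :=
  if r = 0 then w 0 else (∫ s in (0:ℝ)..r, w s) / r

/-- Metric coefficient `f[h](u,r) = exp((1/2)∫₀ʳ (h(u,s)-h̄(u,s))²/s ds)`. -/
noncomputable def metF (h : ℝ → ℝ → ℝ) (u r : ℝ) : ℝ :=
  Real.exp (2⁻¹ * ∫ s in (0:ℝ)..r, (h u s - radAvg (h u) s) ^ 2 / s)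

/-- Metric coefficient `f̃[h](u,r) = (1/r)∫₀ʳ (1-3s²) f[h](u,s) ds` (with value `1` at `r=0`). -/
noncomputable def metFt (h : ℝ → ℝ → ℝ) (u r : ℝ) : ℝ :=
  if r = 0 then 1 else (∫ s in (0:ℝ)..r, (1 - 3 * s ^ 2) * metF h u s) / r

/-- Coefficient `G[h](u,r) = (1/(2r))[(f-f̃)(u,r) - 3 f(u,r) r²]` (with value `0` at `r=0`). -/
noncomputable def coefG (h : ℝ → ℝ → ℝ) (u r : ℝ) : ℝ :=
  if r = 0 then 0 else ((metF h u r - metFt h u r) - 3 * metF h u r * r ^ 2) / (2 * r)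

/-- Coefficient `J[h] = 3G[h] + 3 r f[h] - ((1-3r²)/2) ∂_r f[h]`. -/
noncomputable def coefJ (h : ℝ → ℝ → ℝ) (u r : ℝ) : ℝ :=
  3 * coefG h u r + 3 * r * metF h u r - ((1 - 3 * r ^ 2) / 2) * deriv (fun s => metF h u s) r

theorem measurable_intervalIntegral_param {g : ℝ → ℝ → ℝ} (hg : Measurable (Function.uncurry g)) :
    Measurable fun p : ℝ × ℝ => ∫ s in (0:ℝ)..p.2, g p.1 s := by
  have key : ∀ S : Set ((ℝ × ℝ) × ℝ), MeasurableSet S →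
      Measurable fun p : ℝ × ℝ => ∫ s, S.indicator (fun q => g q.1.1 q.2) (p, s) := by
    intro S hS
    have h1 : Measurable fun q : (ℝ × ℝ) × ℝ => g q.1.1 q.2 :=
      hg.comp ((measurable_fst.comp measurable_fst).prodMk measurable_snd)
    exact ((h1.indicator hS).stronglyMeasurable.integral_prod_right' (ν := volume)).measurable
  have h1 := key {q | 0 < q.2 ∧ q.2 ≤ q.1.2}
    ((measurableSet_lt measurable_const measurable_snd).inter
      (measurableSet_le measurable_snd (measurable_snd.comp measurable_fst)))
  have h2 := key {q | q.1.2 < q.2 ∧ q.2 ≤ 0}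
    ((measurableSet_lt (measurable_snd.comp measurable_fst) measurable_snd).inter
      (measurableSet_le measurable_snd measurable_const))
  convert h1.sub h2 using 1
  ext p
  rw [intervalIntegral, ← integral_indicator measurableSet_Ioc,
    ← integral_indicator measurableSet_Ioc]
  rfl

theorem measurable_radAvg {h : ℝ → ℝ → ℝ} (hh : Measurable (Function.uncurry h)) :
    Measurable fun p : ℝ × ℝ => radAvg (h p.1) p.2 := by
  unfold radAvg
  exact Measurable.ite (measurableSet_eq_fun measurable_snd measurable_const)
    (hh.comp (measurable_fst.prodMk measurable_const))
    ((measurable_intervalIntegral_param hh).div measurable_snd)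

theorem measurable_sq_sub_radAvg_div {h : ℝ → ℝ → ℝ} (hh : Measurable (Function.uncurry h)) :
    Measurable (Function.uncurry fun u s => (h u s - radAvg (h u) s) ^ 2 / s) :=
  ((hh.sub (measurable_radAvg hh)).pow_const 2).div measurable_snd

theorem measurable_metF {h : ℝ → ℝ → ℝ} (hh : Measurable (Function.uncurry h)) :
    Measurable (Function.uncurry (metF h)) :=
  ((measurable_intervalIntegral_param (measurable_sq_sub_radAvg_div hh)).const_mul _).exp

theorem measurable_metFt {h : ℝ → ℝ → ℝ} (hh : Measurable (Function.uncurry h)) :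
    Measurable (Function.uncurry (metFt h)) := by
  have h1 : Measurable (Function.uncurry fun u s => (1 - 3 * s ^ 2) * metF h u s) :=
    (measurable_const.sub ((measurable_snd.pow_const 2).const_mul 3)).mul (measurable_metF hh)
  exact Measurable.ite (measurableSet_eq_fun measurable_snd measurable_const) measurable_const
    ((measurable_intervalIntegral_param h1).div measurable_snd)

theorem measurable_coefG {h : ℝ → ℝ → ℝ} (hh : Measurable (Function.uncurry h)) :
    Measurable (Function.uncurry (coefG h)) := by
  have hF := measurable_metF hh
  refine Measurable.ite (measurableSet_eq_fun measurable_snd measurable_const) measurable_const ?_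
  exact ((hF.sub (measurable_metFt hh)).sub
    ((hF.const_mul 3).mul (measurable_snd.pow_const 2))).div (measurable_snd.const_mul 2)

/-- If `|w'(r)| ≤ x (1+r)^{-3/2}` then `(w - w̄)²/r` decays like `(1+r)^{-2}`. -/
theorem sq_sub_radAvg_div_le {w w' : ℝ → ℝ} {x : ℝ}
    (hw : ∀ r, HasDerivAt w (w' r) r)
    (hb : ∀ r, 0 ≤ r → |w' r| ≤ x * (1 + r) ^ (-(3/2) : ℝ)) {r : ℝ} (hr : 0 ≤ r) :
    (w r - radAvg w r) ^ 2 / r ≤ 4 * x ^ 2 * ((1 + r) ^ 2)⁻¹ := by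
  rcases hr.eq_or_lt with rfl | hr0
  · simp; positivity
  have hx : 0 ≤ x := by
    have := (abs_nonneg _).trans (hb 0 le_rfl)
    simpa using this
  have hwc : Continuous w := continuous_iff_continuousAt.2 fun r => (hw r).continuousAt
  have hA : ∀ t, HasDerivAt (fun t => t * w t - ∫ s in (0:ℝ)..t, w s) (t * w' t) t := by
    intro t
    exact (((hasDerivAt_id t).mul (hw t)).sub
      (hwc.integral_hasStrictDerivAt 0 t).hasDerivAt).congr_deriv (by simp)
  have hB : ∀ t, 0 ≤ t → HasDerivAt (fun t => 2 * x * t ^ 2 * (1 + t) ^ (-(3/2) : ℝ))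
      (2 * x * (2 * t) * (1 + t) ^ (-(3/2) : ℝ)
        + 2 * x * t ^ 2 * (-(3/2) * (1 + t) ^ (-(3/2) - 1 : ℝ))) t := by
    intro t ht
    have h1 : HasDerivAt (fun t : ℝ => 2 * x * t ^ 2) (2 * x * (2 * t)) t := by
      simpa using (hasDerivAt_pow 2 t).const_mul (2 * x)
    have h2 : HasDerivAt (fun t : ℝ => (1 + t) ^ (-(3/2) : ℝ))
        (-(3/2) * (1 + t) ^ (-(3/2) - 1 : ℝ)) t := by
      simpa using ((hasDerivAt_id t).const_add 1).rpow_const (p := -(3/2)) (Or.inl (by simp; linarith))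
    exact h1.mul h2
  have hle := image_norm_le_of_norm_deriv_right_le_deriv_boundary' (a := 0) (b := r)
    (f := fun t => t * w t - ∫ s in (0:ℝ)..t, w s) (f' := fun t => t * w' t)
    (B := fun t => 2 * x * t ^ 2 * (1 + t) ^ (-(3/2) : ℝ))
    (fun t _ => (hA t).continuousAt.continuousWithinAt)
    (fun t _ => (hA t).hasDerivWithinAt) (by simp)
    (fun t ht => (hB t ht.1).continuousAt.continuousWithinAt)
    (fun t ht => (hB t ht.1).hasDerivWithinAt)
    (by
      intro t ht
      have ht0 : 0 ≤ t := ht.1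
      have hp : (0:ℝ) < 1 + t := by linarith
      have h3 : (1 + t) ^ (-(3/2) : ℝ) = (1 + t) ^ (-(3/2) - 1 : ℝ) * (1 + t) := by
        conv_rhs => rw [← rpow_add_one hp.ne']
        norm_num
      have h4 := mul_le_mul_of_nonneg_left (hb t ht0) ht0
      have h5 := rpow_pos_of_pos hp (-(3/2) - 1 : ℝ)
      rw [norm_mul, norm_eq_abs, norm_eq_abs, abs_of_nonneg ht0]
      refine h4.trans ?_
      rw [h3]
      have : 0 ≤ x * t * (1 + t) ^ (-(3/2) - 1 : ℝ) := by positivity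
      nlinarith [mul_nonneg this ht0])
    (right_mem_Icc.2 hr)
  have hp : (0:ℝ) < 1 + r := by linarith
  set q := (1 + r) ^ (-(3/2) : ℝ) with hq
  have hq2 : q ^ 2 = ((1 + r) ^ 3)⁻¹ := by
    rw [hq, ← rpow_natCast, ← rpow_mul hp.le, ← rpow_natCast, ← rpow_neg hp.le]
    norm_num
  have e1 : w r - radAvg w r = (r * w r - ∫ s in (0:ℝ)..r, w s) / r := by
    rw [radAvg, if_neg hr0.ne']; field_simp
  rw [norm_eq_abs] at hle
  have e2 : (r * w r - ∫ s in (0:ℝ)..r, w s) ^ 2 ≤ (2 * x * r ^ 2 * q) ^ 2 := by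
    rw [← sq_abs]
    exact pow_le_pow_left₀ (abs_nonneg _) hle 2
  rw [e1, div_pow, div_div, div_le_iff₀ (by positivity)]
  refine e2.trans ?_
  rw [mul_pow, hq2]
  have e3 : ((1 + r) ^ 3)⁻¹ * r ≤ ((1 + r) ^ 2)⁻¹ := by
    rw [inv_mul_le_iff₀ (by positivity), ← div_eq_mul_inv, le_div_iff₀ (by positivity)]
    nlinarith [pow_pos hp 2]
  have : (2 * x * r ^ 2) ^ 2 * ((1 + r) ^ 3)⁻¹ = 4 * x ^ 2 * r ^ 3 * (((1 + r) ^ 3)⁻¹ * r) := by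
    ring
  rw [this]
  calc _ ≤ 4 * x ^ 2 * r ^ 3 * ((1 + r) ^ 2)⁻¹ := by gcongr
    _ = _ := by ring

theorem intervalIntegrable_of_measurable_of_bound {g : ℝ → ℝ} {a b M : ℝ} (hab : a ≤ b)
    (hg : AEStronglyMeasurable g (volume.restrict (Icc a b))) (hM : ∀ s ∈ Icc a b, |g s| ≤ M) :
    IntervalIntegrable g volume a b := by
  rw [intervalIntegrable_iff_integrableOn_Icc_of_le hab]
  refine Integrable.of_bound hg M ?_
  exact (ae_restrict_mem measurableSet_Icc).mono fun s hs => hM s hs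

/-- A measurable metric coefficient that is nondecreasing, `a`-Lipschitz and `a`-close to `1`. -/
structure NearOne (f : ℝ → ℝ) (a : ℝ) : Prop where
  meas : Measurable f
  nonneg : 0 ≤ a
  one_le : ∀ r, 0 ≤ r → 1 ≤ f r
  le : ∀ r, 0 ≤ r → f r ≤ 1 + a
  mono : ∀ s r, 0 ≤ s → s ≤ r → f s ≤ f r
  lip : ∀ s r, 0 ≤ s → s ≤ r → f r ≤ f s + a * (r - s)

theorem intervalIntegral_const_mul_inv_one_add_sq {s r : ℝ} (hs : 0 ≤ s) (hsr : s ≤ r) (c : ℝ) :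
    IntervalIntegrable (fun t : ℝ => c * ((1 + t) ^ 2)⁻¹) volume s r ∧
    ∫ t in s..r, c * ((1 + t) ^ 2)⁻¹ = c * ((1 + s)⁻¹ - (1 + r)⁻¹) := by
  have hpos : ∀ t ∈ uIcc s r, 0 < 1 + t := by
    intro t ht
    rw [uIcc_of_le hsr] at ht
    linarith [ht.1]
  have hi : IntervalIntegrable (fun t : ℝ => c * ((1 + t) ^ 2)⁻¹) volume s r := by
    refine ContinuousOn.intervalIntegrable ?_
    refine continuousOn_const.mul (ContinuousOn.inv₀ (by fun_prop) ?_)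
    intro t ht
    exact (pow_pos (hpos t ht) 2).ne'
  refine ⟨hi, ?_⟩
  rw [intervalIntegral.integral_eq_sub_of_hasDerivAt (f := fun t => - (c * (1 + t)⁻¹)) _ hi]
  · ring
  · intro t ht
    refine ((((hasDerivAt_id t).const_add 1).inv (hpos t ht).ne').const_mul c).neg.congr_deriv ?_
    simp only [id]
    ring

theorem nearOne_metF {h : ℝ → ℝ → ℝ} (hh : Measurable (Function.uncurry h)) {x u : ℝ}
    (hx : x ^ 2 ≤ 1 / 4)
    (hb : ∀ r, 0 ≤ r → (h u r - radAvg (h u) r) ^ 2 / r ≤ 4 * x ^ 2 * ((1 + r) ^ 2)⁻¹) :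
    NearOne (metF h u) (4 * x ^ 2) := by
  set g : ℝ → ℝ := fun s => (h u s - radAvg (h u) s) ^ 2 / s with hg
  have hgm : Measurable g := (measurable_sq_sub_radAvg_div hh).comp measurable_prodMk_left
  have hg0 : ∀ s, 0 ≤ s → 0 ≤ g s := fun s hs => div_nonneg (sq_nonneg _) hs
  have hint : ∀ s r, 0 ≤ s → s ≤ r → IntervalIntegrable g volume s r := by
    intro s r hs hsr
    refine intervalIntegrable_of_measurable_of_bound (M := 4 * x ^ 2) hsr
      hgm.aestronglyMeasurable ?_
    intro t ht
    have ht0 : 0 ≤ t := hs.trans ht.1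
    rw [abs_of_nonneg (hg0 t ht0)]
    refine (hb t ht0).trans (mul_le_of_le_one_right (by positivity) ?_)
    exact inv_le_one_of_one_le₀ (by nlinarith)
  have hdiff : ∀ s r, 0 ≤ s → s ≤ r →
      ((∫ t in (0:ℝ)..r, g t) = (∫ t in (0:ℝ)..s, g t) + ∫ t in s..r, g t) ∧
      0 ≤ (∫ t in s..r, g t) ∧
      (∫ t in s..r, g t) ≤ 4 * x ^ 2 * ((1 + s)⁻¹ - (1 + r)⁻¹) := by
    intro s r hs hsr
    refine ⟨?_, ?_, ?_⟩
    · rw [intervalIntegral.integral_add_adjacent_intervals (hint 0 s le_rfl hs) (hint s r hs hsr)]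
    · exact intervalIntegral.integral_nonneg hsr fun t ht => hg0 t (hs.trans ht.1)
    · obtain ⟨i1, i2⟩ := intervalIntegral_const_mul_inv_one_add_sq hs hsr (4 * x ^ 2)
      rw [← i2]
      exact intervalIntegral.integral_mono_on hsr (hint s r hs hsr) i1
        fun t ht => hb t (hs.trans ht.1)
  have hF : ∀ r, metF h u r = exp (2⁻¹ * ∫ t in (0:ℝ)..r, g t) := fun r => rfl
  have hexp : exp (2 * x ^ 2) ≤ 2 := by
    have h1 : exp (2 * x ^ 2) ≤ exp (1 / 2) := exp_le_exp.2 (by linarith)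
    have h2 : exp (1 / 2) * exp (1 / 2) = exp 1 := by rw [← exp_add]; norm_num
    nlinarith [exp_one_lt_d9, exp_pos (1 / 2)]
  have htot : ∀ r, 0 ≤ r → 0 ≤ (∫ t in (0:ℝ)..r, g t) ∧ (∫ t in (0:ℝ)..r, g t) ≤ 4 * x ^ 2 := by
    intro r hr
    obtain ⟨-, h2, h3⟩ := hdiff 0 r le_rfl hr
    refine ⟨h2, h3.trans (mul_le_of_le_one_right (by positivity) ?_)⟩
    have : 0 ≤ (1 + r)⁻¹ := by positivity
    simpa using this
  have hF2 : ∀ r, 0 ≤ r → metF h u r ≤ exp (2 * x ^ 2) := by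
    intro r hr
    rw [hF]
    exact exp_le_exp.2 (by linarith [(htot r hr).2])
  refine ⟨(measurable_metF hh).comp measurable_prodMk_left, by positivity, ?_, ?_, ?_, ?_⟩
  · intro r hr
    rw [hF]
    exact one_le_exp (by linarith [(htot r hr).1])
  · intro r hr
    refine (hF2 r hr).trans ?_
    have h1 := add_one_le_exp (-(2 * x ^ 2))
    have h2 : exp (-(2 * x ^ 2)) * exp (2 * x ^ 2) = 1 := by rw [← exp_add]; simp
    nlinarith [exp_pos (2 * x ^ 2), sq_nonneg x]
  · intro s r hs hsr
    obtain ⟨h1, h2, -⟩ := hdiff s r hs hsr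
    rw [hF, hF]
    exact exp_le_exp.2 (by linarith)
  · intro s r hs hsr
    obtain ⟨h1, h2, h3⟩ := hdiff s r hs hsr
    have h4 : (1 + s)⁻¹ - (1 + r)⁻¹ ≤ r - s := by
      have : (1 + s)⁻¹ - (1 + r)⁻¹ = (r - s) * ((1 + s) * (1 + r))⁻¹ := by
        have : 1 + s ≠ 0 := by linarith
        have : 1 + r ≠ 0 := by linarith
        field_simp
        ring
      rw [this]
      exact mul_le_of_le_one_right (by linarith) (inv_le_one_of_one_le₀ (by nlinarith))
    have h5 := hF2 r (hs.trans hsr)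
    have h6 : metF h u s = metF h u r * exp (-(2⁻¹ * ∫ t in s..r, g t)) := by
      rw [hF, hF, ← exp_add, h1]; congr 1; ring
    have h7 := add_one_le_exp (-(2⁻¹ * ∫ t in s..r, g t))
    have h8 : 0 < metF h u r := exp_pos _
    have h9 : (∫ t in s..r, g t) ≤ 4 * x ^ 2 * (r - s) :=
      h3.trans (mul_le_mul_of_nonneg_left h4 (by positivity))
    have h10 : metF h u r * (∫ t in s..r, g t) ≤ 2 * (4 * x ^ 2 * (r - s)) :=
      mul_le_mul (h5.trans hexp) h9 h2 (by norm_num)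
    rw [h6]
    nlinarith [mul_le_mul_of_nonneg_left h7 h8.le]

theorem integral_one_sub_three_sq (A B r : ℝ) :
    ∫ s in (0:ℝ)..r, (A - 3 * B * s ^ 2) = A * r - B * r ^ 3 := by
  rw [intervalIntegral.integral_sub (by simp)
    ((by fun_prop : Continuous fun s : ℝ => 3 * B * s ^ 2).intervalIntegrable _ _),
    intervalIntegral.integral_const_mul, integral_pow]
  simp
  ring

section NearOne

variable {h : ℝ → ℝ → ℝ} {a u r : ℝ}

theorem NearOne.intervalIntegrable (hf : NearOne (metF h u) a) (hr : 0 ≤ r) :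
    IntervalIntegrable (fun s => (1 - 3 * s ^ 2) * metF h u s) volume 0 r := by
  have hi : IntervalIntegrable (metF h u) volume 0 r :=
    intervalIntegrable_of_measurable_of_bound (M := 1 + a) hr hf.meas.aestronglyMeasurable
      fun s hs => by
        rw [abs_of_nonneg (zero_le_one.trans (hf.one_le s hs.1))]
        exact hf.le s hs.1
  exact hi.continuousOn_mul (by fun_prop)

theorem NearOne.integral_le (hf : NearOne (metF h u) a) (hr : 0 ≤ r) {A B : ℝ}
    (hAB : ∀ s ∈ Icc 0 r, (1 - 3 * s ^ 2) * metF h u s ≤ A - 3 * B * s ^ 2) :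
    ∫ s in (0:ℝ)..r, (1 - 3 * s ^ 2) * metF h u s ≤ A * r - B * r ^ 3 := by
  rw [← integral_one_sub_three_sq]
  exact intervalIntegral.integral_mono_on hr (hf.intervalIntegrable hr)
    ((by fun_prop : Continuous fun s : ℝ => A - 3 * B * s ^ 2).intervalIntegrable _ _) hAB

theorem NearOne.le_integral (hf : NearOne (metF h u) a) (hr : 0 ≤ r) {A B : ℝ}
    (hAB : ∀ s ∈ Icc 0 r, A - 3 * B * s ^ 2 ≤ (1 - 3 * s ^ 2) * metF h u s) :
    A * r - B * r ^ 3 ≤ ∫ s in (0:ℝ)..r, (1 - 3 * s ^ 2) * metF h u s := by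
  rw [← integral_one_sub_three_sq]
  exact intervalIntegral.integral_mono_on hr
    ((by fun_prop : Continuous fun s : ℝ => A - 3 * B * s ^ 2).intervalIntegrable _ _)
    (hf.intervalIntegrable hr) hAB

theorem NearOne.metFt_le (hf : NearOne (metF h u) a) (hr : 0 ≤ r) :
    metFt h u r ≤ (1 - r ^ 2) + a * (1 + r ^ 2) := by
  have ha := hf.nonneg
  rcases hr.eq_or_lt with rfl | hr0
  · simpa [metFt] using ha
  rw [metFt, if_neg hr0.ne', div_le_iff₀ hr0]
  refine (hf.integral_le (A := 1 + a) (B := 1 - a) hr fun s hs => ?_).trans_eq (by ring)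
  nlinarith [hf.one_le s hs.1, hf.le s hs.1, mul_nonneg ha (sq_nonneg s),
    mul_nonneg (sq_nonneg s) (sub_nonneg.2 (hf.one_le s hs.1))]

theorem NearOne.le_metFt (hf : NearOne (metF h u) a) (hr : 0 ≤ r) :
    (1 - r ^ 2) - a * (1 + r ^ 2) ≤ metFt h u r := by
  have ha := hf.nonneg
  rcases hr.eq_or_lt with rfl | hr0
  · simpa [metFt] using ha
  rw [metFt, if_neg hr0.ne', le_div_iff₀ hr0]
  refine le_trans (by ring_nf; rfl)
    (hf.le_integral (A := 1 - a) (B := 1 + a) hr fun s hs => ?_)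
  nlinarith [hf.one_le s hs.1, hf.le s hs.1, mul_nonneg ha (sq_nonneg s),
    mul_nonneg (sq_nonneg s) (sub_nonneg.2 (hf.le s hs.1))]

theorem NearOne.coefG_le (hf : NearOne (metF h u) a) (hr : 0 ≤ r) :
    coefG h u r ≤ a / 2 - r := by
  have ha := hf.nonneg
  rcases hr.eq_or_lt with rfl | hr0
  · simp only [coefG, if_true]
    linarith
  have h1 := hf.le_integral (A := metF h u r - a * r) (B := metF h u r) hr fun s hs => by
    have := hf.lip s r hs.1 hs.2
    have := hf.mono s r hs.1 hs.2
    nlinarith [mul_nonneg (sq_nonneg s) (sub_nonneg.2 this), mul_nonneg ha hs.1]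
  have h2 : metF h u r - a * r - metF h u r * r ^ 2 ≤ metFt h u r := by
    rw [metFt, if_neg hr0.ne', le_div_iff₀ hr0]
    linarith
  rw [coefG, if_neg hr0.ne', div_le_iff₀ (by positivity)]
  nlinarith [mul_nonneg (sq_nonneg r) (sub_nonneg.2 (hf.one_le r hr))]

theorem NearOne.le_coefG (hf : NearOne (metF h u) a) (hr : 0 ≤ r) :
    -(3 / 2 * (1 + a) * r) ≤ coefG h u r := by
  rcases hr.eq_or_lt with rfl | hr0
  · simp [coefG]
  have h1 := hf.integral_le (A := metF h u r) (B := 0) hr fun s hs => by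
    have := hf.one_le s hs.1
    have := hf.mono s r hs.1 hs.2
    nlinarith [sq_nonneg s]
  have h2 : metFt h u r ≤ metF h u r := by
    rw [metFt, if_neg hr0.ne', div_le_iff₀ hr0]
    linarith
  rw [coefG, if_neg hr0.ne', le_div_iff₀ (by positivity)]
  nlinarith [mul_nonneg (sq_nonneg r) (sub_nonneg.2 (hf.le r hr))]

/-- `G` is dominated by the derivative of `-2 log (1 + r) + e log (K + r)` along a
characteristic. -/
theorem NearOne.coefG_le_metFt (hf : NearOne (metF h u) a) (hr : 0 ≤ r) {e K : ℝ}
    (he : 0 < e) (hK : 4 * e + 1 ≤ K) (ha1 : a ≤ 1 / 8) (hae : a ≤ e / 4) (haK : a * K ≤ 1 / 8) :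
    coefG h u r ≤ metFt h u r / (1 + r) - e * metFt h u r / (2 * (K + r)) := by
  have ha := hf.nonneg
  have hr1 : 0 < 1 + r := by linarith
  have hKr : 0 < K + r := by linarith
  have h1 : 1 - r - a * (1 + r) ≤ metFt h u r / (1 + r) := by
    rw [le_div_iff₀ hr1]
    nlinarith [hf.le_metFt hr, mul_nonneg ha hr]
  have h2 : e * metFt h u r / (2 * (K + r)) ≤ 1 / 4 + a * K - a * r := by
    rw [div_le_iff₀ (by positivity)]
    have h3 := mul_le_mul_of_nonneg_left (hf.metFt_le hr) he.le
    nlinarith [mul_nonneg he.le (sq_nonneg r), mul_nonneg ha (sq_nonneg K),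
      mul_nonneg (sub_nonneg.2 hae) (sq_nonneg r), mul_nonneg (sub_nonneg.2 ha1) he.le,
      mul_nonneg (mul_nonneg (sub_nonneg.2 ha1) he.le) (sq_nonneg r)]
  linarith [hf.coefG_le hr]

end NearOne

theorem exp_intG_along_characteristic (m δ : ℝ) (hm : 0 < m) (hδ₁ : 0 < δ)
    (hδ₂ : δ < 1/2) (ε : ℝ) (hε : 0 < ε) :
    ∃ x > (0:ℝ), ∃ C > (0:ℝ), ∀ U : ENNReal, 0 < U → ∀ h : ℝ → ℝ → ℝ,
      ContDiff ℝ 1 (Function.uncurry h) →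
      (∀ u r : ℝ, 0 ≤ u → ENNReal.ofReal u ≤ U → 0 ≤ r →
        (1 + r) ^ (2 - δ) * |deriv (h u) r| ≤ x) →
      ∀ u₁ r₁ : ℝ, 0 ≤ u₁ → ENNReal.ofReal u₁ ≤ U → 0 ≤ r₁ →
      ∀ χ : ℝ → ℝ,
        (∀ u ∈ Icc 0 u₁, HasDerivAt χ (-(2⁻¹ * metFt h u (χ u))) u) →
        χ u₁ = r₁ →
        (∀ u ∈ Icc 0 u₁, 0 ≤ χ u) →
      ∀ u ∈ Icc 0 u₁,
        Real.exp (m * ∫ s in u..u₁, coefG h s (χ s)) ≤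
          C * ((1 + χ u) / (1 + r₁)) ^ (2 * m - ε) := by
  obtain ⟨e, he, rfl⟩ : ∃ e, 0 < e ∧ ε = m * e := ⟨ε / m, by positivity, by field_simp⟩
  set K := 4 * e + 1 with hK
  have hK1 : 1 ≤ K := by linarith
  obtain ⟨x, hx, hx1, hx2, hx3⟩ : ∃ x > 0, 4 * x ^ 2 ≤ 1 / 8 ∧ 4 * x ^ 2 ≤ e / 4 ∧
      4 * x ^ 2 * K ≤ 1 / 8 := by
    set b := min (1 / (8 * K)) (e / 4) with hb
    have hb0 : 0 < b := by positivity
    have hb1 : b * K ≤ 1 / 8 := by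
      calc b * K ≤ 1 / (8 * K) * K := by gcongr; exact min_le_left _ _
        _ = 1 / 8 := by field_simp
    have hs : 4 * (√b / 2) ^ 2 = b := by rw [div_pow, sq_sqrt hb0.le]; ring
    exact ⟨√b / 2, by positivity, by rw [hs]; nlinarith, by rw [hs]; exact min_le_right _ _,
      by rw [hs]; exact hb1⟩
  refine ⟨x, hx, K ^ (m * e), by positivity, ?_⟩
  intro U _ h hh hb u₁ r₁ _ hu₁U hr₁ χ hχ hχ₁ hχ0 u hu
  have hmeas : Measurable (Function.uncurry h) := hh.continuous.measurable
  have hnear : ∀ v ∈ Icc 0 u₁, NearOne (metF h v) (4 * x ^ 2) := by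
    intro v hv
    refine nearOne_metF hmeas (by linarith) fun r hr => ?_
    have hd : Differentiable ℝ (h v) :=
      (hh.differentiable (by norm_num)).comp
        ((differentiable_const v).prodMk differentiable_id)
    refine sq_sub_radAvg_div_le (fun r => (hd r).hasDerivAt) (fun r hr => ?_) hr
    have h1 := hb v r hv.1 ((ENNReal.ofReal_le_ofReal hv.2).trans hu₁U) hr
    have hp : 0 < 1 + r := by linarith
    have h2 : (1 + r) ^ (3 / 2 : ℝ) ≤ (1 + r) ^ (2 - δ) :=
      rpow_le_rpow_of_exponent_le (by linarith) (by linarith)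
    rw [rpow_neg hp.le, ← div_eq_mul_inv, le_div_iff₀ (by positivity), mul_comm]
    exact (mul_le_mul_of_nonneg_right h2 (abs_nonneg _)).trans h1
  have hsub : Icc u u₁ ⊆ Icc 0 u₁ := Icc_subset_Icc_left hu.1
  have hχc : ContinuousOn χ (Icc u u₁) := fun v hv =>
    (hχ v (hsub hv)).continuousAt.continuousWithinAt
  have hGint : IntegrableOn (fun s => coefG h s (χ s)) (Icc u u₁) := by
    obtain ⟨M, hM⟩ := isCompact_Icc.bddAbove_image hχc
    have hm1 : AEStronglyMeasurable (fun s => coefG h s (χ s)) (volume.restrict (Icc u u₁)) :=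
      ((measurable_coefG hmeas).comp_aemeasurable
        (aemeasurable_id.prodMk (hχc.aemeasurable measurableSet_Icc))).aestronglyMeasurable
    rw [← intervalIntegrable_iff_integrableOn_Icc_of_le hu.2]
    refine intervalIntegrable_of_measurable_of_bound (M := 1 + 2 * M) hu.2 hm1 fun s hs => ?_
    have h0 := hχ0 s (hsub hs)
    have h1 := (hnear s (hsub hs)).coefG_le h0
    have h2 := (hnear s (hsub hs)).le_coefG h0
    have h3 : χ s ≤ M := hM (mem_image_of_mem _ hs)
    rw [abs_le]
    constructor <;> nlinarith
  set g : ℝ → ℝ := fun v => -(2 * log (1 + χ v)) + e * log (K + χ v) with hg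
  have hgd : ∀ v ∈ Icc u u₁, HasDerivAt g
      (metFt h v (χ v) / (1 + χ v) - e * metFt h v (χ v) / (2 * (K + χ v))) v := by
    intro v hv
    have h0 := hχ0 v (hsub hv)
    have hp1 : 1 + χ v ≠ 0 := by linarith
    have hp2 : K + χ v ≠ 0 := by linarith
    have hd := hχ v (hsub hv)
    refine ((((hd.const_add 1).log hp1).const_mul 2).neg.add
      (((hd.const_add K).log hp2).const_mul e)).congr_deriv ?_
    field_simp
    ring
  have hle := intervalIntegral.integral_le_sub_of_hasDeriv_right_of_le hu.2
    (fun v hv => (hgd v hv).continuousAt.continuousWithinAt)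
    (fun v hv => (hgd v (Ioo_subset_Icc_self hv)).hasDerivWithinAt) hGint
    (fun v hv => (hnear v (hsub (Ioo_subset_Icc_self hv))).coefG_le_metFt
      (hχ0 v (hsub (Ioo_subset_Icc_self hv))) he le_rfl hx1 hx2 hx3)
  have hχu := hχ0 u hu
  have hpu : 0 < 1 + χ u := by linarith
  have hp1 : 0 < 1 + r₁ := by linarith
  have hl1 : log (1 + χ u) ≤ log (K + χ u) := log_le_log hpu (by linarith)
  have hl2 : log (K + r₁) ≤ log K + log (1 + r₁) := by
    rw [← log_mul (by positivity) hp1.ne']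
    exact log_le_log (by positivity) (by nlinarith)
  rw [rpow_def_of_pos (by positivity : 0 < K), rpow_def_of_pos (by positivity), ← exp_add,
    log_div hpu.ne' hp1.ne']
  refine exp_le_exp.2 ?_
  simp only [hg, hχ₁] at hle
  have h1 : (∫ s in u..u₁, coefG h s (χ s)) ≤
      e * log K + (2 - e) * (log (1 + χ u) - log (1 + r₁)) := by
    nlinarith [mul_le_mul_of_nonneg_left hl1 he.le, mul_le_mul_of_nonneg_left hl2 he.le]
  calc _ ≤ m * (e * log K + (2 - e) * (log (1 + χ u) - log (1 + r₁))) := by gcongr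
    _ = _ := by ring
end

section
/- Uniform bounds for the iteration: let 0<δ<1/2, let h₀ ∈ C²([0,∞)) be bounded with ‖h₀'‖_{L^{∞,2-δ}_r}<∞ and ‖h₀''‖_{L^{∞,3-δ}_r}<∞, let U>0 and let h_U ∈ C¹([0,U]×[0,U]) be a solution of Dh_U = G[h_U](h_U - h̄_U) with h_U(0,·)=h₀ on [0,U]. Suppose (w_n)_{n≥1} and (h_n)_{n≥1} are sequences of C¹ functions on [0,U]×[0,∞) satisfying: w₁(u,r)=h₀'(r); h_n(u,r)=h_U(u,0)+∫₀ʳ w_n(u,s)ds; and for each n≥1, w_{n+1} solves the linear transport problem D_n w_{n+1} = 2 G_n w_{n+1} - J_n (h_n - h̄_n)/r with w_{n+1}(0,r)=h₀'(r), where D_n=∂_u-(1/2)f̃[h_n]∂_r, G_n=G[h_n], J_n=J[h_n]. Then there exists x₀'=x₀'(δ)>0 such that, if ‖h₀'‖_{L^{∞,2-δ}_r} ≤ x₀', there exist constants C>0, x'>0 and x''>0 with ‖h_n‖_{L^∞_U L^∞_r} ≤ sup_{0≤u≤U}|h_U(u,0)| + C x', ‖w_n‖_{L^∞_U L^{∞,2-δ}_r}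 ≤ x', and ‖∂_r w_n‖_{L^∞_U L^{∞,3-δ}_r} ≤ x'' for all n ∈ ℤ⁺. -/
open Set MeasureTheory Real Filter

/-- The weighted norm `‖w‖_{L^{∞,p}_r} = sup_{r ≥ 0} (1+r)^p |w(r)|`. -/
noncomputable def wnorm (p : ℝ) (w : ℝ → ℝ) : ℝ :=
  ⨆ r : Ici (0:ℝ), (1 + r.1) ^ p * |w r.1|

/-- The setup of the iteration scheme: `h₀ ∈ C²([0,∞))` bounded with
`‖h₀'‖_{L^{∞,2-δ}_r} < ∞` and `‖h₀''‖_{L^{∞,3-δ}_r} < ∞`; `h_U ∈ C¹` solves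
`Dh_U = G[h_U](h_U - h̄_U)` on `[0,U]²` with `h_U(0,·) = h₀`; `w₁(u,r) = h₀'(r)`,
`h_n(u,r) = h_U(u,0) + ∫₀ʳ w_n(u,s) ds`, and `w_{n+1}` is a `C¹` solution of the
linear transport problem `D_n w_{n+1} = 2 G_n w_{n+1} - J_n (h_n - h̄_n)/r`,
`w_{n+1}(0,·) = h₀'`. -/
def IterSetup (δ U : ℝ) (h₀ : ℝ → ℝ) (hU : ℝ → ℝ → ℝ)
    (w h : ℕ → ℝ → ℝ → ℝ) : Prop :=
  ContDiff ℝ 2 h₀ ∧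
  (∃ M : ℝ, ∀ r : ℝ, 0 ≤ r → |h₀ r| ≤ M) ∧
  BddAbove (range fun r : Ici (0:ℝ) => (1 + r.1) ^ (2 - δ) * |deriv h₀ r.1|) ∧
  BddAbove (range fun r : Ici (0:ℝ) => (1 + r.1) ^ (3 - δ) * |deriv (deriv h₀) r.1|) ∧
  ContDiff ℝ 1 (Function.uncurry hU) ∧
  (∀ u ∈ Icc (0:ℝ) U, ∀ r ∈ Icc (0:ℝ) U,
    deriv (fun u' => hU u' r) u - 2⁻¹ * metFt hU u r * deriv (hU u) r =
      coefG hU u r * (hU u r - radAvg (hU u) r)) ∧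
  (∀ r ∈ Icc (0:ℝ) U, hU 0 r = h₀ r) ∧
  (∀ u r : ℝ, w 1 u r = deriv h₀ r) ∧
  (∀ n : ℕ, 1 ≤ n → ContDiff ℝ 1 (Function.uncurry (w n))) ∧
  (∀ n : ℕ, 1 ≤ n → ∀ u r : ℝ, h n u r = hU u 0 + ∫ s in (0:ℝ)..r, w n u s) ∧
  (∀ n : ℕ, 1 ≤ n → ∀ r : ℝ, 0 ≤ r → w (n + 1) 0 r = deriv h₀ r) ∧
  (∀ n : ℕ, 1 ≤ n → ∀ u ∈ Icc (0:ℝ) U, ∀ r : ℝ, 0 < r →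
    deriv (fun u' => w (n + 1) u' r) u - 2⁻¹ * metFt (h n) u r * deriv (w (n + 1) u) r =
      2 * coefG (h n) u r * w (n + 1) u r -
        coefJ (h n) u r * (h n u r - radAvg (h n u) r) / r)

theorem le_of_hasDerivAt_le {φ ψ φ' ψ' : ℝ → ℝ}
    (hφ : ContinuousOn φ (Ici 0)) (hψ : ContinuousOn ψ (Ici 0))
    (dφ : ∀ x, 0 < x → HasDerivAt φ (φ' x) x) (dψ : ∀ x, 0 < x → HasDerivAt ψ (ψ' x) x)
    (h : ∀ x, 0 < x → φ' x ≤ ψ' x) (h0 : φ 0 ≤ ψ 0) {x : ℝ} (hx : 0 ≤ x) : φ x ≤ ψ x := by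
  have hm : MonotoneOn (fun y => ψ y - φ y) (Ici 0) := by
    apply monotoneOn_of_deriv_nonneg (convex_Ici 0) (hψ.sub hφ)
    · intro y hy
      rw [interior_Ici] at hy
      exact ((dψ y hy).sub (dφ y hy)).differentiableAt.differentiableWithinAt
    · intro y hy
      rw [interior_Ici] at hy
      have := ((dψ y hy).sub (dφ y hy)).deriv
      have h1 := h y hy
      change 0 ≤ deriv (ψ - φ) y
      rw [this]; linarith
  have := hm (mem_Ici.2 le_rfl) (mem_Ici.2 hx) hx
  simp only at this
  linarith

theorem abs_le_of_hasDerivAt_abs_le {φ ψ φ' ψ' : ℝ → ℝ}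
    (hφ : ContinuousOn φ (Ici 0)) (hψ : ContinuousOn ψ (Ici 0))
    (dφ : ∀ x, 0 < x → HasDerivAt φ (φ' x) x) (dψ : ∀ x, 0 < x → HasDerivAt ψ (ψ' x) x)
    (h : ∀ x, 0 < x → |φ' x| ≤ ψ' x) (h0 : |φ 0| ≤ ψ 0) {x : ℝ} (hx : 0 ≤ x) :
    |φ x| ≤ ψ x := by
  rw [abs_le]
  constructor
  · exact le_of_hasDerivAt_le hψ.neg hφ (fun y hy => (dψ y hy).neg) dφ
      (fun y hy => (abs_le.1 (h y hy)).1) (abs_le.1 h0).1 hx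
  · exact le_of_hasDerivAt_le hφ hψ dφ dψ (fun y hy => (abs_le.1 (h y hy)).2) (abs_le.1 h0).2 hx

theorem eq_of_hasDerivAt_eq {φ ψ φ' : ℝ → ℝ}
    (hφ : ContinuousOn φ (Ici 0)) (hψ : ContinuousOn ψ (Ici 0))
    (dφ : ∀ x, 0 < x → HasDerivAt φ (φ' x) x) (dψ : ∀ x, 0 < x → HasDerivAt ψ (φ' x) x)
    (h0 : φ 0 = ψ 0) {x : ℝ} (hx : 0 ≤ x) : φ x = ψ x :=
  le_antisymm (le_of_hasDerivAt_le hφ hψ dφ dψ (fun _ _ => le_rfl) h0.le hx)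
    (le_of_hasDerivAt_le hψ hφ dψ dφ (fun _ _ => le_rfl) h0.ge hx)

theorem integral_eq_integral_max (φ : ℝ → ℝ) {r : ℝ} (hr : 0 ≤ r) :
    ∫ s in (0:ℝ)..r, φ s = ∫ s in (0:ℝ)..r, φ (max s 0) := by
  apply intervalIntegral.integral_congr
  intro s hs
  rw [uIcc_of_le hr] at hs
  simp [max_eq_left hs.1]

theorem continuous_comp_max {φ : ℝ → ℝ} (hφ : ContinuousOn φ (Ici 0)) :
    Continuous fun s => φ (max s 0) :=
  hφ.comp_continuous (by fun_prop) fun s => le_max_right s 0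

theorem hasDerivAt_primitive {φ : ℝ → ℝ} (hφ : ContinuousOn φ (Ici 0)) {r : ℝ} (hr : 0 < r) :
    HasDerivAt (fun x => ∫ s in (0:ℝ)..x, φ s) (φ r) r := by
  have h := (continuous_comp_max hφ).integral_hasStrictDerivAt 0 r |>.hasDerivAt
  rw [max_eq_left hr.le] at h
  apply h.congr_of_eventuallyEq
  filter_upwards [lt_mem_nhds hr] with x hx
  exact integral_eq_integral_max φ hx.le

theorem continuousOn_primitive {φ : ℝ → ℝ} (hφ : ContinuousOn φ (Ici 0)) :
    ContinuousOn (fun x => ∫ s in (0:ℝ)..x, φ s) (Ici 0) := by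
  have h : Continuous fun x => ∫ s in (0:ℝ)..x, φ (max s 0) :=
    intervalIntegral.continuous_primitive
      (fun a b => (continuous_comp_max hφ).intervalIntegrable a b) 0
  exact h.continuousOn.congr fun x hx => integral_eq_integral_max φ hx

theorem continuousOn_Ici_of_hasDerivAt_of_bound {φ : ℝ → ℝ} {C : ℝ}
    (hd : ∀ x, 0 < x → DifferentiableAt ℝ φ x) (hb : ∀ x, 0 ≤ x → |φ x| ≤ C * x) :
    ContinuousOn φ (Ici 0) := by
  intro x hx
  rcases eq_or_lt_of_le (mem_Ici.1 hx) with rfl | hx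
  · have h0 : φ 0 = 0 := by simpa using hb 0 le_rfl
    unfold ContinuousWithinAt
    rw [h0]
    apply squeeze_zero_norm' (a := fun x => C * x)
    · filter_upwards [self_mem_nhdsWithin] with y hy
      exact hb y hy
    · have : Continuous fun x : ℝ => C * x := by fun_prop
      simpa using (this.tendsto 0).mono_left nhdsWithin_le_nhds
  · exact (hd x hx).continuousAt.continuousWithinAt

theorem deriv_sign_of_max {φ : ℝ → ℝ} {φ' a b x c : ℝ} (hφ : HasDerivAt φ φ' x)
    (hx : x ∈ Icc a b) (hmax : ∀ y ∈ Icc a b, φ y ≤ φ x)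
    (ha : x = a → c ≤ 0) (hb : x = b → 0 ≤ c) : 0 ≤ c * φ' := by
  have hpos : a < x → 0 ≤ φ' := by
    intro hax
    by_contra! hneg
    have h := hasDerivWithinAt_iff_tendsto_slope.1 (hφ.hasDerivWithinAt (s := Iio x))
    have hev := (h.eventually (gt_mem_nhds hneg))
    have hs : Iio x \ {x} = Iio x := by simp
    rw [hs] at hev
    obtain ⟨y, hy, hyx⟩ := (hev.and (Ioo_mem_nhdsLT hax)).exists
    rw [slope_def_field, div_neg_iff] at hy
    have := hmax y ⟨hyx.1.le, hyx.2.le.trans hx.2⟩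
    rcases hy with hy | hy <;> linarith [hyx.2]
  have hneg : x < b → φ' ≤ 0 := by
    intro hxb
    by_contra! hpos
    have h := hasDerivWithinAt_iff_tendsto_slope.1 (hφ.hasDerivWithinAt (s := Ioi x))
    have hev := (h.eventually (lt_mem_nhds hpos))
    have hs : Ioi x \ {x} = Ioi x := by simp
    rw [hs] at hev
    obtain ⟨y, hy, hyx⟩ := (hev.and (Ioo_mem_nhdsGT hxb)).exists
    rw [slope_def_field, lt_div_iff₀ (by linarith [hyx.1])] at hy
    have := hmax y ⟨hx.1.trans hyx.1.le, hyx.2.le⟩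
    linarith
  rcases eq_or_lt_of_le hx.1 with h1 | h1 <;> rcases eq_or_lt_of_le hx.2 with h2 | h2
  · have := le_antisymm (ha h1.symm) (hb h2)
    simp [this]
  · exact mul_nonneg_of_nonpos_of_nonpos (ha h1.symm) (hneg h2)
  · exact mul_nonneg (hb h2) (hpos h1)
  · simp [le_antisymm (hneg h2) (hpos h1)]

/-- A continuous profile with the decay `|w(r)| ≤ δ e (1+r)^{-(2-δ)}` on `[0,∞)`. -/
structure DecayProfile (δ e : ℝ) (w : ℝ → ℝ) : Prop where
  δ_pos : 0 < δ
  δ_lt : δ < 1 / 2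
  e_pos : 0 < e
  e_le : e ≤ 1 / 4
  cont : Continuous w
  bound : ∀ r, 0 ≤ r → |w r| ≤ δ * e * (1 + r) ^ (-(2 - δ))

/-- The first moment `∫₀ʳ s w(s) ds`. -/
noncomputable def radMoment (w : ℝ → ℝ) (r : ℝ) : ℝ := ∫ s in (0:ℝ)..r, s * w s

/-- The quotient `(h - h̄)/r` for a primitive `h` of `w`. -/
noncomputable def radQuot (w : ℝ → ℝ) (r : ℝ) : ℝ := radMoment w r / r ^ 2

/-- The function `f` expressed through the derivative `w` of `h`. -/
noncomputable def profF (w : ℝ → ℝ) (r : ℝ) : ℝ :=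
  Real.exp (2⁻¹ * ∫ s in (0:ℝ)..r, s * radQuot w s ^ 2)

/-- The integral `∫₀ʳ (s - s³) ∂ₛf(s) ds`. -/
noncomputable def profA (w : ℝ → ℝ) (r : ℝ) : ℝ :=
  ∫ s in (0:ℝ)..r, (s - s ^ 3) / 2 * profF w s * (s * radQuot w s ^ 2)

theorem hasDerivAt_one_add_rpow (p : ℝ) {r : ℝ} (hr : 0 ≤ r) :
    HasDerivAt (fun x : ℝ => (1 + x) ^ p) (p * (1 + r) ^ p / (1 + r)) r := by
  have h := ((hasDerivAt_id r).const_add 1).rpow_const (p := p) (Or.inl (by simp; linarith))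
  simp only [id] at h
  convert h using 1
  rw [Real.rpow_sub_one (by linarith)]
  ring

theorem continuousOn_one_add_rpow (p : ℝ) : ContinuousOn (fun x : ℝ => (1 + x) ^ p) (Ici 0) :=
  fun _ hx => (hasDerivAt_one_add_rpow p hx).continuousAt.continuousWithinAt

theorem sq_one_add_rpow_le {δ r : ℝ} (hδ : δ < 1 / 2) (hr : 0 ≤ r) :
    ((1 + r) ^ (-(2 - δ))) ^ 2 * (1 + r) ^ 3 ≤ 1 := by
  have h1 : (0:ℝ) < 1 + r := by linarith
  rw [← Real.rpow_natCast, ← Real.rpow_natCast, ← Real.rpow_mul h1.le, ← Real.rpow_add h1]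
  apply Real.rpow_le_one_of_one_le_of_nonpos (by linarith)
  push_cast
  linarith

theorem hasDerivAt_radMoment {w : ℝ → ℝ} (hw : Continuous w) (r : ℝ) :
    HasDerivAt (radMoment w) (r * w r) r :=
  ((continuous_id.mul hw).integral_hasStrictDerivAt 0 r).hasDerivAt

theorem radQuot_zero (w : ℝ → ℝ) : radQuot w 0 = 0 := by simp [radQuot]

theorem hasDerivAt_radQuot {w : ℝ → ℝ} (hw : Continuous w) {r : ℝ} (hr : 0 < r) :
    HasDerivAt (radQuot w) ((w r - 2 * radQuot w r) / r) r := by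
  have h := (hasDerivAt_radMoment hw r).div (hasDerivAt_pow 2 r) (by positivity)
  refine h.congr_deriv ?_
  unfold radQuot
  field_simp
  push_cast
  ring

namespace DecayProfile

variable {δ e : ℝ} {w : ℝ → ℝ}

theorem abs_radMoment_le (H : DecayProfile δ e w) {r : ℝ} (hr : 0 ≤ r) :
    |radMoment w r| ≤ e * (r ^ 2 * (1 + r) ^ (-(2 - δ))) := by
  have hδ := H.δ_pos
  refine abs_le_of_hasDerivAt_abs_le (φ' := fun r => r * w r)
    (ψ := fun r => e * (r ^ 2 * (1 + r) ^ (-(2 - δ))))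
    (ψ' := fun r => e * ((2:ℕ) * r ^ (2 - 1) * (1 + r) ^ (-(2 - δ)) +
      r ^ 2 * (-(2 - δ) * (1 + r) ^ (-(2 - δ)) / (1 + r))))
    (fun x _ => (hasDerivAt_radMoment H.cont x).continuousAt.continuousWithinAt)
    (continuousOn_const.mul ((continuous_pow 2).continuousOn.mul (continuousOn_one_add_rpow _)))
    (fun x _ => hasDerivAt_radMoment H.cont x)
    (fun x hx => ((hasDerivAt_pow 2 x).mul (hasDerivAt_one_add_rpow _ hx.le)).const_mul e)
    ?_ (by simp [radMoment]) hr
  intro x hx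
  have hz : 0 < (1 + x) ^ (-(2 - δ)) := Real.rpow_pos_of_pos (by linarith) _
  have hb := H.bound x hx.le
  set z := (1 + x) ^ (-(2 - δ))
  rw [abs_mul, abs_of_pos hx]
  have hq : x / (1 + x) ≤ 1 := by rw [div_le_one (by linarith)]; linarith
  calc x * |w x| ≤ x * (δ * e * z) := by gcongr
    _ ≤ e * (x * z * (2 - (2 - δ) * (x / (1 + x)))) := by
      have : 0 ≤ e * (x * z) := by have := H.e_pos; positivity
      have h2 : 0 ≤ (2 - δ) * (1 - x / (1 + x)) :=
        mul_nonneg (by linarith [H.δ_lt]) (by linarith)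
      nlinarith [mul_nonneg this h2]
    _ = _ := by push_cast; field_simp; ring

theorem abs_radQuot_le (H : DecayProfile δ e w) {r : ℝ} (hr : 0 ≤ r) :
    |radQuot w r| ≤ e * (1 + r) ^ (-(2 - δ)) := by
  have he := H.e_pos
  rcases eq_or_lt_of_le hr with rfl | hr
  · simp [radQuot_zero, he.le]
  · rw [radQuot, abs_div, abs_of_pos (by positivity : 0 < r ^ 2), div_le_iff₀ (by positivity)]
    calc _ ≤ _ := H.abs_radMoment_le hr.le
      _ = _ := by ring

theorem sq_radQuot_le (H : DecayProfile δ e w) {r : ℝ} (hr : 0 ≤ r) :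
    radQuot w r ^ 2 * (1 + r) ^ 3 ≤ e ^ 2 := by
  have h1 := H.abs_radQuot_le hr
  have h2 := sq_one_add_rpow_le H.δ_lt hr
  have h3 : radQuot w r ^ 2 ≤ (e * (1 + r) ^ (-(2 - δ))) ^ 2 := by
    rw [← sq_abs]; gcongr
  calc radQuot w r ^ 2 * (1 + r) ^ 3 ≤ (e * (1 + r) ^ (-(2 - δ))) ^ 2 * (1 + r) ^ 3 := by gcongr
    _ = e ^ 2 * (((1 + r) ^ (-(2 - δ))) ^ 2 * (1 + r) ^ 3) := by ring
    _ ≤ e ^ 2 * 1 := by gcongr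
    _ = e ^ 2 := mul_one _

theorem continuousOn_energy (H : DecayProfile δ e w) :
    ContinuousOn (fun s => s * radQuot w s ^ 2) (Ici 0) := by
  apply continuousOn_Ici_of_hasDerivAt_of_bound (C := e ^ 2)
  · intro x hx
    have := (hasDerivAt_radQuot H.cont hx).differentiableAt
    fun_prop
  · intro x hx
    have h := H.sq_radQuot_le hx
    rw [abs_mul, abs_of_nonneg hx, abs_of_nonneg (sq_nonneg _), mul_comm]
    refine mul_le_mul_of_nonneg_right ?_ hx
    exact (le_mul_of_one_le_right (sq_nonneg _) (one_le_pow₀ (by linarith))).trans h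

theorem hasDerivAt_profF (H : DecayProfile δ e w) {r : ℝ} (hr : 0 < r) :
    HasDerivAt (profF w) (profF w r * (r * radQuot w r ^ 2) / 2) r := by
  have h := ((hasDerivAt_primitive H.continuousOn_energy hr).const_mul 2⁻¹).exp
  refine h.congr_deriv ?_
  unfold profF
  ring

theorem continuousOn_profF (H : DecayProfile δ e w) : ContinuousOn (profF w) (Ici 0) :=
  Real.continuous_exp.comp_continuousOn
    ((continuousOn_primitive H.continuousOn_energy).const_smul (2⁻¹ : ℝ))

theorem profF_mem (H : DecayProfile δ e w) {r : ℝ} (hr : 0 ≤ r) :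
    1 ≤ profF w r ∧ profF w r ≤ 2 := by
  have he := H.e_pos
  have hlow : 0 ≤ ∫ s in (0:ℝ)..r, s * radQuot w s ^ 2 :=
    intervalIntegral.integral_nonneg hr fun s hs => mul_nonneg hs.1 (sq_nonneg _)
  have hup : ∫ s in (0:ℝ)..r, s * radQuot w s ^ 2 ≤ e ^ 2 * (1 - (1 + r)⁻¹) := by
    refine le_of_hasDerivAt_le (ψ := fun r => e ^ 2 * (1 - (1 + r)⁻¹))
      (ψ' := fun r => e ^ 2 * (-(-1 / (1 + r) ^ 2)))
      (continuousOn_primitive H.continuousOn_energy) ?_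
      (fun x hx => hasDerivAt_primitive H.continuousOn_energy hx)
      (fun x hx => ?_) ?_ (by simp) hr
    · intro x hx
      have : 1 + x ≠ 0 := by have := mem_Ici.1 hx; linarith
      exact ContinuousAt.continuousWithinAt (by fun_prop (disch := assumption))
    · have h := ((hasDerivAt_id x).const_add 1).inv (by simp; linarith)
      exact (h.const_sub 1).const_mul (e ^ 2)
    · intro x hx
      have h := H.sq_radQuot_le hx.le
      have h1 : (0:ℝ) < 1 + x := by linarith
      rw [neg_div, neg_neg, mul_one_div, le_div_iff₀ (by positivity)]
      calc x * radQuot w x ^ 2 * (1 + x) ^ 2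
          ≤ (1 + x) * radQuot w x ^ 2 * (1 + x) ^ 2 := by gcongr; linarith
        _ = radQuot w x ^ 2 * (1 + x) ^ 3 := by ring
        _ ≤ e ^ 2 := h
  have hup' : e ^ 2 * (1 - (1 + r)⁻¹) ≤ 1 / 16 := by
    have : 0 ≤ (1 + r)⁻¹ := by positivity
    have := H.e_le
    have : e ^ 2 ≤ 1 / 16 := by nlinarith
    nlinarith
  constructor
  · exact Real.one_le_exp (by positivity)
  · have h := Real.exp_one_lt_d9
    have hs : Real.exp (2⁻¹ * ∫ s in (0:ℝ)..r, s * radQuot w s ^ 2) ≤ Real.exp (1 / 2) := by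
      apply Real.exp_le_exp.2; linarith
    have h2 : Real.exp (1 / 2) ^ 2 = Real.exp 1 := by
      rw [← Real.exp_nat_mul]; norm_num
    unfold profF
    nlinarith [Real.exp_pos (1 / 2)]

theorem continuousOn_profA_integrand (H : DecayProfile δ e w) :
    ContinuousOn (fun s => (s - s ^ 3) / 2 * profF w s * (s * radQuot w s ^ 2)) (Ici 0) := by
  have h : Continuous fun s : ℝ => (s - s ^ 3) / 2 := by fun_prop
  exact (h.continuousOn.mul H.continuousOn_profF).mul H.continuousOn_energy

theorem hasDerivAt_profA (H : DecayProfile δ e w) {r : ℝ} (hr : 0 < r) :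
    HasDerivAt (profA w) ((r - r ^ 3) / 2 * profF w r * (r * radQuot w r ^ 2)) r :=
  hasDerivAt_primitive H.continuousOn_profA_integrand hr

theorem continuousOn_profA (H : DecayProfile δ e w) : ContinuousOn (profA w) (Ici 0) :=
  continuousOn_primitive H.continuousOn_profA_integrand

theorem abs_deriv_profA_le (H : DecayProfile δ e w) {r : ℝ} (hr : 0 ≤ r) :
    |(r - r ^ 3) / 2 * profF w r * (r * radQuot w r ^ 2)| * (1 + r) ≤ e ^ 2 * r ^ 2 := by
  obtain ⟨hf1, hf2⟩ := H.profF_mem hr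
  have h := H.sq_radQuot_le hr
  set f := profF w r
  set y := radQuot w r ^ 2 with hy
  have hy0 : 0 ≤ y := sq_nonneg _
  have h1 : |(r - r ^ 3) / 2 * f * (r * y)| ≤ r ^ 2 * (1 + r) ^ 2 * y := by
    have h2 : |1 - r ^ 2| ≤ (1 + r) ^ 2 := by
      rw [abs_le]; constructor <;> nlinarith
    have h3 : (r - r ^ 3) / 2 * f * (r * y) = (1 - r ^ 2) * (r ^ 2 * y * (f / 2)) := by ring
    have h4 : 0 ≤ r ^ 2 * y * (f / 2) := by positivity
    rw [h3, abs_mul, abs_of_nonneg h4]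
    calc |1 - r ^ 2| * (r ^ 2 * y * (f / 2)) ≤ (1 + r) ^ 2 * (r ^ 2 * y * 1) := by
          gcongr; linarith
      _ = _ := by ring
  calc _ ≤ r ^ 2 * (1 + r) ^ 2 * y * (1 + r) := by gcongr
    _ = r ^ 2 * (y * (1 + r) ^ 3) := by ring
    _ ≤ r ^ 2 * e ^ 2 := by gcongr
    _ = _ := by ring

theorem abs_profA_le_cube (H : DecayProfile δ e w) {r : ℝ} (hr : 0 ≤ r) :
    |profA w r| ≤ e ^ 2 / 3 * r ^ 3 := by
  refine abs_le_of_hasDerivAt_abs_le (ψ := fun r => e ^ 2 / 3 * r ^ 3)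
    (ψ' := fun r => e ^ 2 / 3 * ((3:ℕ) * r ^ (3 - 1))) H.continuousOn_profA
    (by fun_prop) (fun x hx => H.hasDerivAt_profA hx)
    (fun x _ => (hasDerivAt_pow 3 x).const_mul _) ?_ (by simp [profA]) hr
  intro x hx
  have h := H.abs_deriv_profA_le hx.le
  have := abs_nonneg ((x - x ^ 3) / 2 * profF w x * (x * radQuot w x ^ 2))
  calc _ ≤ e ^ 2 * x ^ 2 := by nlinarith
    _ = _ := by push_cast; ring

theorem abs_profA_le_sq (H : DecayProfile δ e w) {r : ℝ} (hr : 0 ≤ r) :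
    |profA w r| ≤ e ^ 2 / 2 * r ^ 2 := by
  refine abs_le_of_hasDerivAt_abs_le (ψ := fun r => e ^ 2 / 2 * r ^ 2)
    (ψ' := fun r => e ^ 2 / 2 * ((2:ℕ) * r ^ (2 - 1))) H.continuousOn_profA
    (by fun_prop) (fun x hx => H.hasDerivAt_profA hx)
    (fun x _ => (hasDerivAt_pow 2 x).const_mul _) ?_ (by simp [profA]) hr
  intro x hx
  have h := H.abs_deriv_profA_le hx.le
  have := abs_nonneg ((x - x ^ 3) / 2 * profF w x * (x * radQuot w x ^ 2))
  have h2 : |(x - x ^ 3) / 2 * profF w x * (x * radQuot w x ^ 2)| * (1 + x) ≤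
      (e ^ 2 * x) * (1 + x) := by nlinarith [mul_nonneg (sq_nonneg e) hx.le]
  have h3 := le_of_mul_le_mul_right h2 (by linarith)
  calc _ ≤ e ^ 2 * x := h3
    _ = _ := by push_cast; ring

end DecayProfile

/-- Bounds on the coefficients of the transport equation
`∂ᵤv - (1/2) F ∂ᵣv = 2 G v - S` at a fixed time. -/
structure CoeffBounds (δ e : ℝ) (F G S : ℝ → ℝ) : Prop where
  F_zero : F 0 = 1
  F_nonpos : ∀ r, 2 ≤ r → F r ≤ 0
  G_nonpos : ∀ r, 0 ≤ r → G r ≤ 0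
  damping : ∀ r, 0 ≤ r → 2 * G r - (2 - δ) / 2 * (F r / (1 + r)) ≤ -(1 / 2) * (1 + r)
  damping_deriv : ∀ r, 0 ≤ r → 3 * G r - (3 - δ) / 2 * (F r / (1 + r)) ≤ -(1 / 2) * (1 + r)
  S_bound : ∀ r, 0 ≤ r → |S r| ≤ 3 * e ^ 3 * (1 + r) ^ (-(2 - δ))
  hasDerivAt_F : ∀ r, 0 < r → HasDerivAt F (2 * G r) r
  hasDerivAt_G : ∀ r, 0 < r → ∃ G', HasDerivAt G G' r ∧ -4 ≤ G' ∧ G' ≤ 0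
  hasDerivAt_S : ∀ r, 0 < r → ∃ S', HasDerivAt S S' r ∧ |S'| ≤ 26 * e * (1 + r) ^ (-(2 - δ))
  continuousOn_F : ContinuousOn F (Ici 0)
  continuousOn_G : ContinuousOn G (Ici 0)
  continuousOn_S : ContinuousOn S (Ici 0)

/-- The coefficient `f̃` expressed through the derivative of `h`. -/
noncomputable def profFt (w : ℝ → ℝ) (r : ℝ) : ℝ := (1 - r ^ 2) * profF w r - profA w r / r

/-- The coefficient `G` expressed through the derivative of `h`. -/
noncomputable def profG (w : ℝ → ℝ) (r : ℝ) : ℝ := -(r * profF w r) + profA w r / r ^ 2 / 2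

/-- The coefficient `J` expressed through the derivative of `h`. -/
noncomputable def profJ (w : ℝ → ℝ) (r : ℝ) : ℝ :=
  3 / 2 * (profA w r / r ^ 2) - (1 - 3 * r ^ 2) / 4 * (profF w r * (r * radQuot w r ^ 2))

namespace DecayProfile

variable {δ e : ℝ} {w : ℝ → ℝ}

theorem abs_profA_div_le (H : DecayProfile δ e w) {r : ℝ} (hr : 0 ≤ r) :
    |profA w r / r| ≤ e ^ 2 / 3 * r ^ 2 := by
  rcases eq_or_lt_of_le hr with rfl | hr
  · simp
  · rw [abs_div, abs_of_pos hr, div_le_iff₀ hr]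
    calc _ ≤ _ := H.abs_profA_le_cube hr.le
      _ = _ := by ring

theorem abs_profA_div_sq_le (H : DecayProfile δ e w) {r : ℝ} (hr : 0 ≤ r) :
    |profA w r / r ^ 2| ≤ e ^ 2 / 3 * r := by
  rcases eq_or_lt_of_le hr with rfl | hr
  · simp
  · rw [abs_div, abs_of_pos (by positivity : 0 < r ^ 2), div_le_iff₀ (by positivity)]
    calc _ ≤ _ := H.abs_profA_le_cube hr.le
      _ = _ := by ring

theorem abs_profA_div_sq_le_const (H : DecayProfile δ e w) {r : ℝ} (hr : 0 ≤ r) :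
    |profA w r / r ^ 2| ≤ e ^ 2 / 2 := by
  rcases eq_or_lt_of_le hr with rfl | hr
  · simp; positivity
  · rw [abs_div, abs_of_pos (by positivity : 0 < r ^ 2), div_le_iff₀ (by positivity)]
    exact H.abs_profA_le_sq hr.le

theorem abs_profA_div_cube_le (H : DecayProfile δ e w) {r : ℝ} (hr : 0 < r) :
    |profA w r / r ^ 3| ≤ e ^ 2 / 3 := by
  rw [abs_div, abs_of_pos (by positivity : 0 < r ^ 3), div_le_iff₀ (by positivity)]
  exact H.abs_profA_le_cube hr.le

theorem sq_e_le (H : DecayProfile δ e w) : e ^ 2 ≤ 1 / 16 := by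
  nlinarith [H.e_pos, H.e_le]

theorem profFt_zero : profFt w 0 = 1 := by
  simp [profFt, profF]

theorem profFt_nonpos (H : DecayProfile δ e w) {r : ℝ} (hr : 2 ≤ r) : profFt w r ≤ 0 := by
  obtain ⟨h1, -⟩ := H.profF_mem (by linarith : 0 ≤ r)
  have h2 := (abs_le.1 (H.abs_profA_div_le (by linarith : 0 ≤ r))).1
  have h3 := H.sq_e_le
  unfold profFt
  nlinarith [mul_nonneg (by linarith : 0 ≤ 1 / 16 - e ^ 2) (sq_nonneg r),
    mul_nonneg (by nlinarith : 0 ≤ r ^ 2 - 1) (by linarith : 0 ≤ profF w r - 1)]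

theorem profG_nonpos (H : DecayProfile δ e w) {r : ℝ} (hr : 0 ≤ r) : profG w r ≤ 0 := by
  obtain ⟨h1, -⟩ := H.profF_mem hr
  have h2 := (abs_le.1 (H.abs_profA_div_sq_le hr)).2
  have h3 := H.sq_e_le
  unfold profG
  nlinarith

theorem abs_profG_le (H : DecayProfile δ e w) {r : ℝ} (hr : 0 ≤ r) : |profG w r| ≤ 3 * r := by
  obtain ⟨-, h1⟩ := H.profF_mem hr
  have h2 := (abs_le.1 (H.abs_profA_div_sq_le hr)).1
  have h3 := H.sq_e_le
  rw [abs_of_nonpos (H.profG_nonpos hr)]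
  unfold profG
  nlinarith

theorem profFt_div (r : ℝ) (hr : 0 ≤ r) : profFt w r / (1 + r) =
    (1 - r) * profF w r - profA w r / r ^ 2 * (r / (1 + r)) := by
  have h1 : 1 + r ≠ 0 := by linarith
  unfold profFt
  rcases eq_or_lt_of_le hr with rfl | hr
  · simp
  · field_simp
    ring

theorem damping_aux (H : DecayProfile δ e w) {r a b : ℝ} (hr : 0 ≤ r) (ha : a ≤ 3 / 2)
    (ha' : 3 / 4 ≤ a) (hb : b ≤ 3) (hab : 1 ≤ b - a) :
    b * profG w r - a * (profFt w r / (1 + r)) ≤ -(1 / 2) * (1 + r) := by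
  obtain ⟨h1, -⟩ := H.profF_mem hr
  have h2 := H.abs_profA_div_sq_le hr
  have h3 := H.sq_e_le
  have hq0 : 0 ≤ r / (1 + r) := by positivity
  have hq : r / (1 + r) ≤ 1 := by rw [div_le_one (by linarith)]; linarith
  rw [profFt_div r hr]
  unfold profG
  set α := profA w r / r ^ 2
  set f := profF w r
  set t := r / (1 + r)
  have h4 : |α| ≤ r / 48 := by nlinarith
  have h5 : (b / 2 + a * t) * α ≤ 3 * (r / 48) := by
    calc (b / 2 + a * t) * α ≤ (b / 2 + a * t) * |α| := by
          gcongr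
          · nlinarith
          · exact le_abs_self _
      _ ≤ 3 * (r / 48) := by
          gcongr
          nlinarith
  have h6 : (3 / 4 + r) * 1 ≤ (a + (b - a) * r) * f := by
    gcongr
    nlinarith
  nlinarith

theorem abs_profJ_le (H : DecayProfile δ e w) {r : ℝ} (hr : 0 ≤ r) :
    |profJ w r| ≤ 3 * e ^ 2 ∧ |profJ w r| ≤ 3 * e ^ 2 * r := by
  obtain ⟨h1, h1'⟩ := H.profF_mem hr
  have h2 := H.abs_profA_div_sq_le hr
  have h3 := H.abs_profA_div_sq_le_const hr
  have h4 := H.sq_radQuot_le hr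
  unfold profJ
  set α := profA w r / r ^ 2
  set f := profF w r
  set y := radQuot w r ^ 2 with hy
  have hy0 : 0 ≤ y := sq_nonneg _
  have h5 : |(1 - 3 * r ^ 2) / 4 * (f * (r * y))| ≤ 3 / 2 * ((1 + r) ^ 2 * y) * r := by
    have h2 : |1 - 3 * r ^ 2| ≤ 3 * (1 + r) ^ 2 := by
      rw [abs_le]; constructor <;> nlinarith
    have h3 : (1 - 3 * r ^ 2) / 4 * (f * (r * y)) = (1 - 3 * r ^ 2) * (r * y * (f / 4)) := by ring
    have h4 : 0 ≤ r * y * (f / 4) := by positivity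
    rw [h3, abs_mul, abs_of_nonneg h4]
    calc |1 - 3 * r ^ 2| * (r * y * (f / 4)) ≤ (3 * (1 + r) ^ 2) * (r * y * (2 / 4)) := by
          gcongr
      _ = _ := by ring
  have h6 : |3 / 2 * α - (1 - 3 * r ^ 2) / 4 * (f * (r * y))| ≤
      3 / 2 * |α| + 3 / 2 * ((1 + r) ^ 2 * y) * r := by
    refine (abs_sub _ _).trans ?_
    rw [abs_mul, abs_of_pos (by norm_num : (0:ℝ) < 3 / 2)]
    gcongr
  have h7 : 0 ≤ (1 + r) ^ 2 * y := by positivity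
  have h8 : (1 + r) ^ 2 * y + (1 + r) ^ 2 * y * r ≤ e ^ 2 := by linarith
  constructor
  · nlinarith
  · nlinarith [mul_nonneg h7 hr]

theorem hasDerivAt_profFt (H : DecayProfile δ e w) {r : ℝ} (hr : 0 < r) :
    HasDerivAt (profFt w) (2 * profG w r) r := by
  have h1 := (((hasDerivAt_pow 2 r).const_sub 1).mul (H.hasDerivAt_profF hr)).sub
    ((H.hasDerivAt_profA hr).div (hasDerivAt_id r) hr.ne')
  refine h1.congr_deriv ?_
  unfold profG
  simp only [id]
  field_simp
  push_cast
  ring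

theorem hasDerivAt_profA_div_sq (H : DecayProfile δ e w) {r : ℝ} (hr : 0 < r) :
    HasDerivAt (fun r => profA w r / r ^ 2)
      ((1 - r ^ 2) / 2 * (profF w r * radQuot w r ^ 2) - 2 * (profA w r / r ^ 3)) r := by
  refine ((H.hasDerivAt_profA hr).div (hasDerivAt_pow 2 r) (by positivity)).congr_deriv ?_
  field_simp
  push_cast
  ring

theorem hasDerivAt_profG (H : DecayProfile δ e w) {r : ℝ} (hr : 0 < r) :
    ∃ G', HasDerivAt (profG w) G' r ∧ -4 ≤ G' ∧ G' ≤ 0 := by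
  obtain ⟨h1, h1'⟩ := H.profF_mem hr.le
  have h2 := abs_le.1 (H.abs_profA_div_cube_le hr)
  have h3 := H.sq_e_le
  have h4 := H.sq_radQuot_le hr.le
  refine ⟨_, ((hasDerivAt_id r).mul (H.hasDerivAt_profF hr)).neg.add
    ((H.hasDerivAt_profA_div_sq hr).div_const 2), ?_⟩
  simp only [id]
  set β := profA w r / r ^ 3
  set f := profF w r
  set y := radQuot w r ^ 2 with hy
  have hy0 : 0 ≤ y := sq_nonneg _
  have h5 : y + r ^ 2 * y ≤ e ^ 2 := by
    nlinarith [mul_nonneg hr.le hy0, mul_nonneg (pow_pos hr 3).le hy0,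
      mul_nonneg (pow_pos hr 2).le hy0]
  have h6 : f * (y + r ^ 2 * y) ≤ 2 * e ^ 2 := by gcongr
  have h7 : 0 ≤ f * y := by positivity
  have h8 : 0 ≤ f * (r ^ 2 * y) := by positivity
  constructor <;> nlinarith

theorem abs_sub_radQuot_le (H : DecayProfile δ e w) {r : ℝ} (hr : 0 ≤ r) :
    |w r - 2 * radQuot w r| ≤ 3 * (e * (1 + r) ^ (-(2 - δ))) := by
  have h1 := H.bound r hr
  have h2 := H.abs_radQuot_le hr
  have hz : 0 < (1 + r) ^ (-(2 - δ)) := Real.rpow_pos_of_pos (by linarith) _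
  set z := (1 + r) ^ (-(2 - δ))
  have h3 : δ * e * z ≤ e * z := by
    have := mul_pos H.e_pos hz
    nlinarith [H.δ_lt]
  refine (abs_sub _ _).trans ?_
  rw [abs_mul, abs_two]
  linarith

theorem hasDerivAt_profJ (H : DecayProfile δ e w) {r : ℝ} (hr : 0 < r) :
    ∃ J', HasDerivAt (profJ w) J' r ∧ |J'| ≤ 18 * e ^ 2 := by
  obtain ⟨h1, h1'⟩ := H.profF_mem hr.le
  have h2 := abs_le.1 (H.abs_profA_div_cube_le hr)
  have h3 := H.sq_e_le
  have h4 := H.sq_radQuot_le hr.le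
  have hq := H.abs_radQuot_le hr.le
  have hw := H.bound r hr.le
  have hz := sq_one_add_rpow_le H.δ_lt hr.le
  have hd := (((H.hasDerivAt_profA_div_sq hr).const_mul (3 / 2)).sub
    ((((((hasDerivAt_pow 2 r).const_mul 3).const_sub 1).div_const 4)).mul
    ((H.hasDerivAt_profF hr).mul ((hasDerivAt_id r).mul
      ((hasDerivAt_radQuot H.cont hr).pow 2)))))
  have hval := hd.congr_deriv (g' := 3 / 4 * ((1 - r ^ 2) * (profF w r * radQuot w r ^ 2)) -
      3 * (profA w r / r ^ 3) + 3 / 2 * (r ^ 2 * (profF w r * radQuot w r ^ 2)) -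
      1 / 4 * ((1 - 3 * r ^ 2) * (profF w r * (r ^ 2 * radQuot w r ^ 2 / 2 * radQuot w r ^ 2 +
        radQuot w r ^ 2 + 2 * (radQuot w r * (w r - 2 * radQuot w r)))))) (by
    simp only [id, Pi.pow_apply, Pi.mul_apply]
    field_simp
    push_cast
    ring)
  refine ⟨_, hval, ?_⟩
  have hp : |radQuot w r * (w r - 2 * radQuot w r)| * (1 + r) ^ 3 ≤ 3 * e ^ 2 := by
    have h5 := H.abs_sub_radQuot_le hr.le
    have he := H.e_pos
    have hz0 : 0 < (1 + r) ^ (-(2 - δ)) := Real.rpow_pos_of_pos (by linarith) _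
    rw [abs_mul]
    set z := (1 + r) ^ (-(2 - δ))
    calc |radQuot w r| * |w r - 2 * radQuot w r| * (1 + r) ^ 3
        ≤ (e * z) * (3 * (e * z)) * (1 + r) ^ 3 := by gcongr
      _ = 3 * e ^ 2 * (z ^ 2 * (1 + r) ^ 3) := by ring
      _ ≤ 3 * e ^ 2 * 1 := by gcongr
      _ = _ := mul_one _
  set p := radQuot w r * (w r - 2 * radQuot w r)
  set β := profA w r / r ^ 3
  set f := profF w r
  set y := radQuot w r ^ 2 with hy
  have hy0 : 0 ≤ y := sq_nonneg _
  have hY : (1 + r) ^ 2 * y ≤ e ^ 2 := by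
    nlinarith [mul_nonneg hr.le (mul_nonneg (sq_nonneg (1 + r)) hy0)]
  have hP : (1 + r) ^ 2 * |p| ≤ 3 * e ^ 2 := by
    nlinarith [mul_nonneg hr.le (mul_nonneg (sq_nonneg (1 + r)) (abs_nonneg p))]
  have hry : r ^ 2 * y ≤ e ^ 2 := by nlinarith [mul_nonneg hr.le hy0]
  have hfy : f * y ≤ 2 * y := by gcongr
  have hfy0 : 0 ≤ f * y := by positivity
  have b1 : |(1 - r ^ 2) * (f * y)| ≤ 2 * e ^ 2 := by
    have h2 : |1 - r ^ 2| ≤ (1 + r) ^ 2 := by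
      rw [abs_le]; constructor <;> nlinarith
    rw [abs_mul, abs_of_nonneg hfy0]
    calc _ ≤ (1 + r) ^ 2 * (2 * y) := by gcongr
      _ ≤ _ := by linarith
  have b2 : |r ^ 2 * (f * y)| ≤ 2 * e ^ 2 := by
    rw [abs_of_nonneg (by positivity)]
    nlinarith
  have bg : |f * (r ^ 2 * y / 2 * y + y + 2 * p)| ≤ 4 * (y + |p|) := by
    have h6 : r ^ 2 * y / 2 * y ≤ y := by nlinarith
    have h7 : |r ^ 2 * y / 2 * y + y + 2 * p| ≤ 2 * (y + |p|) := by
      refine (abs_add_le _ _).trans ?_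
      rw [abs_of_nonneg (by positivity), abs_mul, abs_two]
      linarith
    rw [abs_mul, abs_of_nonneg (by linarith : 0 ≤ f)]
    calc _ ≤ 2 * (2 * (y + |p|)) := by gcongr
      _ = _ := by ring
  have b3 : |(1 - 3 * r ^ 2) * (f * (r ^ 2 * y / 2 * y + y + 2 * p))| ≤ 48 * e ^ 2 := by
    have h2 : |1 - 3 * r ^ 2| ≤ 3 * (1 + r) ^ 2 := by
      rw [abs_le]; constructor <;> nlinarith
    rw [abs_mul]
    calc _ ≤ (3 * (1 + r) ^ 2) * (4 * (y + |p|)) := by gcongr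
      _ ≤ _ := by nlinarith
  have b1' := abs_le.1 b1
  have b2' := abs_le.1 b2
  have b3' := abs_le.1 b3
  rw [abs_le]
  constructor <;> linarith

theorem continuousOn_profFt (H : DecayProfile δ e w) : ContinuousOn (profFt w) (Ici 0) := by
  have h1 : ContinuousOn (fun r => profA w r / r) (Ici 0) := by
    intro x hx
    rcases eq_or_lt_of_le (mem_Ici.1 hx) with rfl | hx
    · unfold ContinuousWithinAt
      simp only [div_zero]
      apply squeeze_zero_norm' (a := fun x => e ^ 2 / 3 * x ^ 2)
      · filter_upwards [self_mem_nhdsWithin] with y hy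
        exact H.abs_profA_div_le hy
      · have : Continuous fun x : ℝ => e ^ 2 / 3 * x ^ 2 := by fun_prop
        simpa using (this.tendsto 0).mono_left nhdsWithin_le_nhds
    · exact ((H.hasDerivAt_profA hx).div (hasDerivAt_id x) hx.ne').continuousAt.continuousWithinAt
  have h2 : Continuous fun r : ℝ => 1 - r ^ 2 := by fun_prop
  exact (h2.continuousOn.mul H.continuousOn_profF).sub h1

theorem hasDerivAt_profS (H : DecayProfile δ e w) {r : ℝ} (hr : 0 < r) :
    ∃ S', HasDerivAt (fun r => profJ w r * radQuot w r) S' r ∧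
      |S'| ≤ 26 * e * (1 + r) ^ (-(2 - δ)) := by
  obtain ⟨J', hJ', hJb⟩ := H.hasDerivAt_profJ hr
  have h1 := H.abs_radQuot_le hr.le
  have h2 := H.abs_sub_radQuot_le hr.le
  have h3 := (H.abs_profJ_le hr.le).2
  have hz : 0 < (1 + r) ^ (-(2 - δ)) := Real.rpow_pos_of_pos (by linarith) _
  refine ⟨_, hJ'.mul (hasDerivAt_radQuot H.cont hr), ?_⟩
  set z := (1 + r) ^ (-(2 - δ))
  have he := H.e_pos
  refine (abs_add_le _ _).trans ?_
  rw [abs_mul, abs_mul, abs_div, abs_of_pos hr]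
  calc |J'| * |radQuot w r| + |profJ w r| * (|w r - 2 * radQuot w r| / r)
      ≤ 18 * e ^ 2 * (e * z) + 3 * e ^ 2 * r * (3 * (e * z) / r) := by gcongr
    _ = 27 * e ^ 2 * (e * z) := by field_simp; ring
    _ ≤ 26 * (e * z) := by
      gcongr
      linarith [H.sq_e_le]
    _ = _ := by ring

theorem abs_profS_le (H : DecayProfile δ e w) {r : ℝ} (hr : 0 ≤ r) :
    |profJ w r * radQuot w r| ≤ 3 * e ^ 3 * (1 + r) ^ (-(2 - δ)) := by
  rw [abs_mul]
  calc _ ≤ 3 * e ^ 2 * (e * (1 + r) ^ (-(2 - δ))) := by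
        gcongr
        · exact (H.abs_profJ_le hr).1
        · exact H.abs_radQuot_le hr
    _ = _ := by ring

theorem coeffBounds (H : DecayProfile δ e w) :
    CoeffBounds δ e (profFt w) (profG w) (fun r => profJ w r * radQuot w r) where
  F_zero := profFt_zero
  F_nonpos _ hr := H.profFt_nonpos hr
  G_nonpos _ hr := H.profG_nonpos hr
  damping _ hr := by
    have := H.δ_pos
    have := H.δ_lt
    apply H.damping_aux hr <;> linarith
  damping_deriv _ hr := by
    have := H.δ_pos
    have := H.δ_lt
    apply H.damping_aux hr <;> linarith
  S_bound _ hr := H.abs_profS_le hr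
  hasDerivAt_F _ hr := H.hasDerivAt_profFt hr
  hasDerivAt_G _ hr := H.hasDerivAt_profG hr
  hasDerivAt_S _ hr := H.hasDerivAt_profS hr
  continuousOn_F := H.continuousOn_profFt
  continuousOn_G := by
    refine continuousOn_Ici_of_hasDerivAt_of_bound (C := 3) (fun x hx => ?_)
      fun x hx => H.abs_profG_le hx
    obtain ⟨_, h, -⟩ := H.hasDerivAt_profG hx
    exact h.differentiableAt
  continuousOn_S := by
    refine continuousOn_Ici_of_hasDerivAt_of_bound (C := 3 * e ^ 2 * e) (fun x hx => ?_)
      fun x hx => ?_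
    · obtain ⟨_, h, -⟩ := H.hasDerivAt_profS hx
      exact h.differentiableAt
    · have hz : (1 + x) ^ (-(2 - δ)) ≤ 1 :=
        Real.rpow_le_one_of_one_le_of_nonpos (by linarith) (by linarith [H.δ_lt])
      have he := H.e_pos
      have h1 : |radQuot w x| ≤ e :=
        (H.abs_radQuot_le hx).trans (mul_le_of_le_one_right he.le hz)
      rw [abs_mul]
      calc _ ≤ 3 * e ^ 2 * x * e := by
            gcongr
            exact (H.abs_profJ_le hx).2
        _ = _ := by ring

end DecayProfile

section Identification

variable {δ e : ℝ} {w : ℝ → ℝ} {h : ℝ → ℝ → ℝ} {u c : ℝ}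

theorem sub_radAvg_eq (hw : Continuous w) (hh : ∀ r, h u r = c + ∫ s in (0:ℝ)..r, w s)
    {r : ℝ} (hr : 0 ≤ r) : h u r - radAvg (h u) r = r * radQuot w r := by
  have hd : ∀ x, HasDerivAt (h u) (w x) x := fun x => by
    have h1 := ((hw.integral_hasStrictDerivAt 0 x).hasDerivAt).const_add c
    have h2 : h u = fun r => c + ∫ s in (0:ℝ)..r, w s := funext hh
    rwa [h2]
  have hc : Continuous (h u) := continuous_iff_continuousAt.2 fun x => (hd x).continuousAt
  have hm : r * h u r - ∫ s in (0:ℝ)..r, h u s = radMoment w r := by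
    have hd1 : ∀ x, HasDerivAt (fun r => r * h u r - ∫ s in (0:ℝ)..r, h u s) (x * w x) x :=
      fun x => (((hasDerivAt_id x).mul (hd x)).sub
        (hc.integral_hasStrictDerivAt 0 x).hasDerivAt).congr_deriv (by simp)
    exact eq_of_hasDerivAt_eq (fun x _ => (hd1 x).continuousAt.continuousWithinAt)
      (fun x _ => (hasDerivAt_radMoment hw x).continuousAt.continuousWithinAt)
      (fun x _ => hd1 x) (fun x _ => hasDerivAt_radMoment hw x) (by simp [radMoment]) hr
  rcases eq_or_lt_of_le hr with rfl | hr
  · simp [radAvg]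
  · rw [radAvg, if_neg hr.ne', radQuot, ← hm]
    field_simp

theorem metF_eq (hw : Continuous w) (hh : ∀ r, h u r = c + ∫ s in (0:ℝ)..r, w s)
    {r : ℝ} (hr : 0 ≤ r) : metF h u r = profF w r := by
  unfold metF profF
  congr 2
  apply intervalIntegral.integral_congr
  intro s hs
  rw [uIcc_of_le hr] at hs
  simp only
  rw [sub_radAvg_eq hw hh hs.1]
  rcases eq_or_lt_of_le hs.1 with rfl | hs
  · simp
  · field_simp

theorem metFt_eq (H : DecayProfile δ e w) (hh : ∀ r, h u r = c + ∫ s in (0:ℝ)..r, w s)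
    {r : ℝ} (hr : 0 ≤ r) : metFt h u r = profFt w r := by
  rcases eq_or_lt_of_le hr with rfl | hr
  · simp [metFt, DecayProfile.profFt_zero]
  have hp : Continuous fun s : ℝ => 1 - 3 * s ^ 2 := by fun_prop
  have hintegrand : ContinuousOn (fun s => (1 - 3 * s ^ 2) * profF w s) (Ici 0) :=
    hp.continuousOn.mul H.continuousOn_profF
  have h1 : ∫ s in (0:ℝ)..r, (1 - 3 * s ^ 2) * metF h u s =
      ∫ s in (0:ℝ)..r, (1 - 3 * s ^ 2) * profF w s := by
    apply intervalIntegral.integral_congr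
    intro s hs
    rw [uIcc_of_le hr.le] at hs
    simp only
    rw [metF_eq H.cont hh hs.1]
  have h2 : ∫ s in (0:ℝ)..r, (1 - 3 * s ^ 2) * profF w s =
      (r - r ^ 3) * profF w r - profA w r := by
    have hq : Continuous fun s : ℝ => s - s ^ 3 := by fun_prop
    refine eq_of_hasDerivAt_eq (ψ := fun r => (r - r ^ 3) * profF w r - profA w r)
      (continuousOn_primitive hintegrand)
      ((hq.continuousOn.mul H.continuousOn_profF).sub H.continuousOn_profA)
      (fun x hx => hasDerivAt_primitive hintegrand hx)
      (fun x hx => ((((hasDerivAt_id x).sub (hasDerivAt_pow 3 x)).mul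
        (H.hasDerivAt_profF hx)).sub (H.hasDerivAt_profA hx)).congr_deriv ?_)
      (by simp [profA]) hr.le
    simp only [id, Pi.sub_apply]
    push_cast
    ring
  rw [metFt, if_neg hr.ne', h1, h2]
  unfold profFt
  field_simp

theorem coefG_eq (H : DecayProfile δ e w) (hh : ∀ r, h u r = c + ∫ s in (0:ℝ)..r, w s)
    {r : ℝ} (hr : 0 ≤ r) : coefG h u r = profG w r := by
  rcases eq_or_lt_of_le hr with rfl | hr
  · simp [coefG, profG]
  · rw [coefG, if_neg hr.ne', metFt_eq H hh hr.le, metF_eq H.cont hh hr.le]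
    unfold profG profFt
    field_simp
    ring

theorem coefJ_eq (H : DecayProfile δ e w) (hh : ∀ r, h u r = c + ∫ s in (0:ℝ)..r, w s)
    {r : ℝ} (hr : 0 < r) : coefJ h u r = profJ w r := by
  have hd : deriv (fun s => metF h u s) r = profF w r * (r * radQuot w r ^ 2) / 2 := by
    apply HasDerivAt.deriv
    apply (H.hasDerivAt_profF hr).congr_of_eventuallyEq
    filter_upwards [lt_mem_nhds hr] with x hx
    exact metF_eq H.cont hh hx.le
  rw [coefJ, hd, coefG_eq H hh hr.le, metF_eq H.cont hh hr.le]
  unfold profG profJ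
  ring

theorem coefS_eq (H : DecayProfile δ e w) (hh : ∀ r, h u r = c + ∫ s in (0:ℝ)..r, w s)
    {r : ℝ} (hr : 0 < r) :
    coefJ h u r * (h u r - radAvg (h u) r) / r = profJ w r * radQuot w r := by
  rw [coefJ_eq H hh hr, sub_radAvg_eq H.cont hh hr.le]
  field_simp

end Identification

section Transport

variable {δ e U X K : ℝ} {v : ℝ → ℝ → ℝ} {F G S : ℝ → ℝ → ℝ}

theorem hasDerivAt_fst (hv : ContDiff ℝ 1 (Function.uncurry v)) (u r : ℝ) :
    HasDerivAt (fun u' => v u' r) (fderiv ℝ (Function.uncurry v) (u, r) (1, 0)) u := by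
  have h1 := (hv.differentiable one_ne_zero (u, r)).hasFDerivAt
  have h2 : HasDerivAt (fun u' : ℝ => (u', r)) ((1 : ℝ), (0 : ℝ)) u :=
    (hasDerivAt_id u).prodMk (hasDerivAt_const u r)
  exact h1.comp_hasDerivAt u h2

theorem hasDerivAt_snd (hv : ContDiff ℝ 1 (Function.uncurry v)) (u r : ℝ) :
    HasDerivAt (v u) (fderiv ℝ (Function.uncurry v) (u, r) (0, 1)) r := by
  have h1 := (hv.differentiable one_ne_zero (u, r)).hasFDerivAt
  have h2 : HasDerivAt (fun r' : ℝ => (u, r')) ((0 : ℝ), (1 : ℝ)) r :=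
    (hasDerivAt_const r u).prodMk (hasDerivAt_id r)
  exact h1.comp_hasDerivAt r h2

theorem continuous_deriv_fst (hv : ContDiff ℝ 1 (Function.uncurry v)) (u : ℝ) :
    Continuous fun r => deriv (fun u' => v u' r) u := by
  have h : (fun r => deriv (fun u' => v u' r) u) =
      fun r => fderiv ℝ (Function.uncurry v) (u, r) (1, 0) :=
    funext fun r => (hasDerivAt_fst hv u r).deriv
  rw [h]
  have := hv.continuous_fderiv one_ne_zero
  fun_prop

theorem continuous_deriv_snd (hv : ContDiff ℝ 1 (Function.uncurry v)) (u : ℝ) :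
    Continuous fun r => deriv (v u) r := by
  have h : (fun r => deriv (v u) r) =
      fun r => fderiv ℝ (Function.uncurry v) (u, r) (0, 1) :=
    funext fun r => (hasDerivAt_snd hv u r).deriv
  rw [h]
  have := hv.continuous_fderiv one_ne_zero
  fun_prop

/-- The function `v` solves `∂ᵤv - (1/2) F ∂ᵣv = 2 G v - S` on `[0,U] × [0,∞)`. -/
structure SolvesTransport (U : ℝ) (F G S v : ℝ → ℝ → ℝ) : Prop where
  contDiff : ContDiff ℝ 1 (Function.uncurry v)
  eqn : ∀ u ∈ Icc (0:ℝ) U, ∀ r : ℝ, 0 ≤ r →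
    deriv (fun u' => v u' r) u - 2⁻¹ * F u r * deriv (v u) r = 2 * G u r * v u r - S u r

theorem SolvesTransport.of_pos (hv : ContDiff ℝ 1 (Function.uncurry v))
    (hc : ∀ u ∈ Icc (0:ℝ) U, CoeffBounds δ e (F u) (G u) (S u))
    (heq : ∀ u ∈ Icc (0:ℝ) U, ∀ r : ℝ, 0 < r →
      deriv (fun u' => v u' r) u - 2⁻¹ * F u r * deriv (v u) r = 2 * G u r * v u r - S u r) :
    SolvesTransport U F G S v := by
  refine ⟨hv, fun u hu r hr => ?_⟩
  have hvu : Continuous (v u) :=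
    continuous_iff_continuousAt.2 fun r => (hasDerivAt_snd hv u r).continuousAt
  have h := hc u hu
  have hEq : EqOn (fun r => deriv (fun u' => v u' r) u - 2⁻¹ * F u r * deriv (v u) r)
      (fun r => 2 * G u r * v u r - S u r) (Ioi 0) := fun r hr => heq u hu r hr
  refine hEq.of_subset_closure (t := Ici 0) ?_ ?_ Ioi_subset_Ici_self (by simp) hr
  · exact (continuous_deriv_fst hv u).continuousOn.sub
      ((continuousOn_const.mul h.continuousOn_F).mul (continuous_deriv_snd hv u).continuousOn)
  · exact ((continuousOn_const.mul h.continuousOn_G).mul hvu.continuousOn).sub h.continuousOn_S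

theorem CoeffBounds.neg_source {F G S : ℝ → ℝ} (h : CoeffBounds δ e F G S) :
    CoeffBounds δ e F G fun r => -S r where
  F_zero := h.F_zero
  F_nonpos := h.F_nonpos
  G_nonpos := h.G_nonpos
  damping := h.damping
  damping_deriv := h.damping_deriv
  S_bound r hr := by rw [abs_neg]; exact h.S_bound r hr
  hasDerivAt_F := h.hasDerivAt_F
  hasDerivAt_G := h.hasDerivAt_G
  hasDerivAt_S r hr := by
    obtain ⟨S', h1, h2⟩ := h.hasDerivAt_S r hr
    exact ⟨-S', h1.neg, by rwa [abs_neg]⟩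
  continuousOn_F := h.continuousOn_F
  continuousOn_G := h.continuousOn_G
  continuousOn_S := h.continuousOn_S.neg

theorem CoeffBounds.antitoneOn_G {F G S : ℝ → ℝ} (h : CoeffBounds δ e F G S) :
    AntitoneOn G (Ici 0) := by
  apply antitoneOn_of_deriv_nonpos (convex_Ici 0) h.continuousOn_G
  · intro x hx
    rw [interior_Ici] at hx
    obtain ⟨_, h1, -⟩ := h.hasDerivAt_G x hx
    exact h1.differentiableAt.differentiableWithinAt
  · intro x hx
    rw [interior_Ici] at hx
    obtain ⟨_, h1, -, h2⟩ := h.hasDerivAt_G x hx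
    rwa [h1.deriv]

theorem SolvesTransport.neg (hv : SolvesTransport U F G S v) :
    SolvesTransport U F G (fun u r => -S u r) (fun u r => -v u r) where
  contDiff := hv.contDiff.neg
  eqn u hu r hr := by
    have h := hv.eqn u hu r hr
    have h1 : deriv (fun r => -v u r) r = -deriv (v u) r := deriv.fun_neg
    rw [deriv.fun_neg, h1]
    linarith

theorem SolvesTransport.le_of_initial_le (hv : SolvesTransport U F G S v)
    (hc : ∀ u ∈ Icc (0:ℝ) U, CoeffBounds δ e (F u) (G u) (S u)) (hX : 6 * e ^ 3 < X) (he : 0 < e)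
    (h0 : ∀ r, 0 ≤ r → v 0 r ≤ X * (1 + r) ^ (-(2 - δ))) {u r : ℝ} (hu : u ∈ Icc 0 U)
    (hr : 0 ≤ r) : v u r ≤ X * (1 + r) ^ (-(2 - δ)) := by
  by_contra! hlt
  have hK : IsCompact (Icc (0:ℝ) U ×ˢ Icc (0:ℝ) (r + 2)) := isCompact_Icc.prod isCompact_Icc
  have hcont : ContinuousOn (fun p : ℝ × ℝ => v p.1 p.2 - X * (1 + p.2) ^ (-(2 - δ)))
      (Icc (0:ℝ) U ×ˢ Icc (0:ℝ) (r + 2)) := by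
    have h1 : Continuous fun p : ℝ × ℝ => v p.1 p.2 := hv.contDiff.continuous
    exact h1.continuousOn.sub (continuousOn_const.mul
      ((continuousOn_one_add_rpow _).comp continuousOn_snd fun p hp => hp.2.1))
  obtain ⟨⟨u₀, r₀⟩, ⟨hu₀, hr₀⟩, hmax⟩ :=
    hK.exists_isMaxOn ⟨(u, r), hu, hr, by simp⟩ hcont
  have hpos : 0 < v u₀ r₀ - X * (1 + r₀) ^ (-(2 - δ)) :=
    lt_of_lt_of_le (sub_pos.2 hlt)
      (hmax (show (u, r) ∈ _ from ⟨hu, hr, by simp⟩))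
  simp only at hu₀ hr₀
  have hne : u₀ ≠ 0 := by
    rintro rfl
    linarith [h0 r₀ hr₀.1]
  have hcu := hc u₀ hu₀
  have hdu := deriv_sign_of_max (c := 1)
    ((hasDerivAt_fst hv.contDiff u₀ r₀).sub_const (X * (1 + r₀) ^ (-(2 - δ)))) hu₀
    (fun y hy => hmax (show (y, r₀) ∈ _ from ⟨hy, hr₀⟩)) (fun h => absurd h hne)
    (fun _ => zero_le_one)
  have hdr := deriv_sign_of_max (c := -F u₀ r₀)
    ((hasDerivAt_snd hv.contDiff u₀ r₀).sub
      ((hasDerivAt_one_add_rpow (-(2 - δ)) hr₀.1).const_mul X)) hr₀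
    (fun y hy => hmax (show (u₀, y) ∈ _ from ⟨hu₀, hy⟩))
    (fun h => by rw [h, hcu.F_zero]; norm_num)
    (fun h => by have := hcu.F_nonpos r₀ (by linarith); linarith)
  have heq := hv.eqn u₀ hu₀ r₀ hr₀.1
  rw [(hasDerivAt_fst hv.contDiff u₀ r₀).deriv, (hasDerivAt_snd hv.contDiff u₀ r₀).deriv] at heq
  have hz : 0 < (1 + r₀) ^ (-(2 - δ)) := Real.rpow_pos_of_pos (by linarith [hr₀.1]) _
  have hS := (abs_le.1 (hcu.S_bound r₀ hr₀.1)).1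
  have hdamp := hcu.damping r₀ hr₀.1
  have hG := hcu.G_nonpos r₀ hr₀.1
  set z := (1 + r₀) ^ (-(2 - δ))
  set q := F u₀ r₀ / (1 + r₀)
  have hX0 : 0 < X := lt_trans (by positivity) hX
  have h1 : 2 * G u₀ r₀ * v u₀ r₀ ≤ 2 * G u₀ r₀ * (X * z) := by nlinarith
  have h2 : X * z * (2 * G u₀ r₀ - (2 - δ) / 2 * q) ≤ X * z * (-(1 / 2)) := by
    refine mul_le_mul_of_nonneg_left ?_ (by positivity)
    linarith [hr₀.1]
  have h3 : F u₀ r₀ * (X * (-(2 - δ) * z / (1 + r₀))) = -(X * z * ((2 - δ) * q)) := by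
    simp only [q]; ring
  have h4 : 6 * e ^ 3 * z < X * z := mul_lt_mul_of_pos_right hX hz
  nlinarith

theorem SolvesTransport.abs_le_of_initial_le (hv : SolvesTransport U F G S v)
    (hc : ∀ u ∈ Icc (0:ℝ) U, CoeffBounds δ e (F u) (G u) (S u)) (hX : 6 * e ^ 3 < X) (he : 0 < e)
    (h0 : ∀ r, 0 ≤ r → |v 0 r| ≤ X * (1 + r) ^ (-(2 - δ))) {u r : ℝ} (hu : u ∈ Icc 0 U)
    (hr : 0 ≤ r) : |v u r| ≤ X * (1 + r) ^ (-(2 - δ)) := by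
  rw [abs_le']
  exact ⟨hv.le_of_initial_le hc hX he (fun r hr => (abs_le'.1 (h0 r hr)).1) hu hr,
    hv.neg.le_of_initial_le (fun u hu => (hc u hu).neg_source) hX he
      (fun r hr => (abs_le'.1 (h0 r hr)).2) hu hr⟩

/-- An antiderivative of `(1+r)^{-(3-δ)}`. -/
noncomputable def decayPrim (δ r : ℝ) : ℝ := -(1 / (2 - δ)) * (1 + r) ^ (-(2 - δ))

theorem one_add_rpow_succ (δ : ℝ) {r : ℝ} (hr : 0 ≤ r) :
    (1 + r) ^ (-(2 - δ)) / (1 + r) = (1 + r) ^ (-(3 - δ)) := by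
  rw [← Real.rpow_sub_one (by linarith)]
  congr 1
  ring

theorem hasDerivAt_decayPrim (hδ : δ < 2) {r : ℝ} (hr : 0 ≤ r) :
    HasDerivAt (decayPrim δ) ((1 + r) ^ (-(3 - δ))) r := by
  refine ((hasDerivAt_one_add_rpow (-(2 - δ)) hr).const_mul (-(1 / (2 - δ)))).congr_deriv ?_
  rw [← one_add_rpow_succ δ hr]
  have : 2 - δ ≠ 0 := by linarith
  field_simp

theorem rpow_half_le (hδ₁ : 0 < δ) (hδ₂ : δ < 1) {r s : ℝ} (hs : 0 ≤ s)
    (h : 2 * (1 + s) ≤ 1 + r) : (1 + r) ^ (-(2 - δ)) ≤ (1 + s) ^ (-(2 - δ)) / 2 := by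
  calc (1 + r) ^ (-(2 - δ)) ≤ (2 * (1 + s)) ^ (-(2 - δ)) :=
        Real.rpow_le_rpow_of_nonpos (by linarith) h (by linarith)
    _ = 2 ^ (-(2 - δ)) * (1 + s) ^ (-(2 - δ)) := Real.mul_rpow (by norm_num) (by linarith)
    _ ≤ 2 ^ (-(1:ℝ)) * (1 + s) ^ (-(2 - δ)) := by
        gcongr
        · norm_num
        · linarith
    _ = _ := by rw [Real.rpow_neg_one]; ring

theorem rpow_le_four_mul (hδ₁ : 0 < δ) (hδ₂ : δ < 2) {s t : ℝ} (ht : 0 ≤ t)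
    (h : 1 + t ≤ 2 * (1 + s)) : (1 + s) ^ (-(2 - δ)) ≤ 4 * (1 + t) ^ (-(2 - δ)) := by
  calc (1 + s) ^ (-(2 - δ)) ≤ (2⁻¹ * (1 + t)) ^ (-(2 - δ)) :=
        Real.rpow_le_rpow_of_nonpos (by linarith) (by linarith) (by linarith)
    _ = 2⁻¹ ^ (-(2 - δ)) * (1 + t) ^ (-(2 - δ)) := Real.mul_rpow (by norm_num) (by linarith)
    _ ≤ 2⁻¹ ^ (-(2:ℝ)) * (1 + t) ^ (-(2 - δ)) := by
        refine mul_le_mul_of_nonneg_right ?_ (Real.rpow_nonneg (by linarith) _)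
        exact Real.rpow_le_rpow_of_exponent_ge (by norm_num) (by norm_num) (by linarith)
    _ = _ := by
        congr 1
        rw [Real.rpow_neg (by norm_num), Real.inv_rpow (by norm_num), inv_inv]
        norm_num

theorem CoeffBounds.strictAntiOn_two_point {F G S : ℝ → ℝ} (h : CoeffBounds δ e F G S)
    (hδ₁ : 0 < δ) (hδ₂ : δ < 1 / 2) (he : 0 < e) (hK : 116 * e < K) {r s a : ℝ} (hs : 0 ≤ s)
    (hrs : 1 + r ≤ 2 * (1 + s)) (ha : |a| ≤ e * (1 + s) ^ (-(2 - δ))) :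
    StrictAntiOn (fun t => 2 * G r * K * decayPrim δ t + 2 * a * G t - S t +
      K / 2 * (F t * (1 + t) ^ (-(3 - δ)))) (Icc s r) := by
  have hsub : Icc s r ⊆ Ici 0 := fun t ht => hs.trans ht.1
  apply strictAntiOn_of_deriv_neg (convex_Icc s r)
  · have hP : ContinuousOn (decayPrim δ) (Ici 0) := fun t ht =>
      (hasDerivAt_decayPrim (by linarith) ht).continuousAt.continuousWithinAt
    exact ((((continuousOn_const.mul hP).add (continuousOn_const.mul h.continuousOn_G)).sub
      h.continuousOn_S).add (continuousOn_const.mul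
      (h.continuousOn_F.mul (continuousOn_one_add_rpow _)))).mono hsub
  · intro t ht
    rw [interior_Icc] at ht
    have ht0 : 0 < t := hs.trans_lt ht.1
    obtain ⟨G', hG', hG1, hG2⟩ := h.hasDerivAt_G t ht0
    obtain ⟨S', hS', hSb⟩ := h.hasDerivAt_S t ht0
    have hd := ((((hasDerivAt_decayPrim (δ := δ) (by linarith) ht0.le).const_mul
      (2 * G r * K)).add (hG'.const_mul (2 * a))).sub hS').add
      (((h.hasDerivAt_F t ht0).mul (hasDerivAt_one_add_rpow (-(3 - δ)) ht0.le)).const_mul (K / 2))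
    have hderiv := hd.deriv
    change deriv _ t = _ at hderiv
    refine lt_of_eq_of_lt hderiv ?_
    have hmono := h.antitoneOn_G (mem_Ici.2 ht0.le) (mem_Ici.2 (ht0.le.trans ht.2.le)) ht.2.le
    have hz4 := rpow_le_four_mul hδ₁ (by linarith) ht0.le
      (by linarith [ht.2] : 1 + t ≤ 2 * (1 + s))
    have hdamp := h.damping_deriv t ht0.le
    have hzp : (1 + t) ^ (-(2 - δ)) = (1 + t) ^ (-(3 - δ)) * (1 + t) := by
      rw [← one_add_rpow_succ δ ht0.le]
      field_simp
    have hp : 0 < (1 + t) ^ (-(3 - δ)) := Real.rpow_pos_of_pos (by linarith) _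
    have hz : 0 < (1 + t) ^ (-(2 - δ)) := Real.rpow_pos_of_pos (by linarith) _
    set p := (1 + t) ^ (-(3 - δ))
    set z := (1 + t) ^ (-(2 - δ))
    have haz : |a| ≤ 4 * e * z := by nlinarith
    have h1 : 2 * a * G' ≤ 32 * e * z := by
      calc 2 * a * G' ≤ |2 * a * G'| := le_abs_self _
        _ = 2 * |a| * |G'| := by rw [abs_mul, abs_mul, abs_two]
        _ ≤ 2 * (4 * e * z) * 4 := by
          gcongr
          rw [abs_le]
          constructor <;> linarith
        _ = _ := by ring
    have h2 := (abs_le.1 hSb).1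
    have hKp : 0 < K * p := mul_pos (by linarith) hp
    have h3 : K * p * (2 * G r + (G t - (3 - δ) / 2 * (F t / (1 + t)))) ≤
        K * p * (-(1 / 2) * (1 + t)) := by
      refine mul_le_mul_of_nonneg_left ?_ hKp.le
      linarith
    have h4 : 116 * e * z < K * z := mul_lt_mul_of_pos_right hK hz
    calc _ = K * p * (2 * G r + (G t - (3 - δ) / 2 * (F t / (1 + t)))) + 2 * a * G' - S' := by
          ring
      _ ≤ K * p * (-(1 / 2) * (1 + t)) + 32 * e * z + 26 * e * z := by linarith
      _ = -(1 / 2) * K * z + 58 * e * z := by rw [hzp]; ring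
      _ < 0 := by linarith

theorem SolvesTransport.sub_le_of_initial (hv : SolvesTransport U F G S v)
    (hc : ∀ u ∈ Icc (0:ℝ) U, CoeffBounds δ e (F u) (G u) (S u))
    (hδ₁ : 0 < δ) (hδ₂ : δ < 1 / 2) (he : 0 < e) (hK : 116 * e < K)
    (hb : ∀ u ∈ Icc (0:ℝ) U, ∀ r, 0 ≤ r → |v u r| ≤ e * (1 + r) ^ (-(2 - δ)))
    (h0 : ∀ s r, 0 ≤ s → s ≤ r → v 0 r - v 0 s ≤ K * (decayPrim δ r - decayPrim δ s))
    {u r s : ℝ} (hu : u ∈ Icc 0 U) (hs : 0 ≤ s) (hsr : s ≤ r) :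
    v u r - v u s ≤ K * (decayPrim δ r - decayPrim δ s) := by
  by_contra! hlt
  have hP : ContinuousOn (decayPrim δ) (Ici 0) := fun t ht =>
    (hasDerivAt_decayPrim (by linarith) ht).continuousAt.continuousWithinAt
  set D : Set (ℝ × ℝ × ℝ) :=
    (Icc (0:ℝ) U ×ˢ (Icc (0:ℝ) (r + 2) ×ˢ Icc (0:ℝ) (r + 2))) ∩ {p | p.2.2 ≤ p.2.1} with hD
  have hcomp : IsCompact D :=
    (isCompact_Icc.prod (isCompact_Icc.prod isCompact_Icc)).inter_right
      (isClosed_le (by fun_prop) (by fun_prop))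
  have hcont : ContinuousOn (fun p : ℝ × ℝ × ℝ => v p.1 p.2.1 - v p.1 p.2.2 -
      K * (decayPrim δ p.2.1 - decayPrim δ p.2.2)) D := by
    have hvc : Continuous (Function.uncurry v) := hv.contDiff.continuous
    have h1 : Continuous fun p : ℝ × ℝ × ℝ => v p.1 p.2.1 :=
      hvc.comp (by fun_prop : Continuous fun p : ℝ × ℝ × ℝ => (p.1, p.2.1))
    have h2 : Continuous fun p : ℝ × ℝ × ℝ => v p.1 p.2.2 :=
      hvc.comp (by fun_prop : Continuous fun p : ℝ × ℝ × ℝ => (p.1, p.2.2))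
    exact (h1.sub h2).continuousOn.sub (continuousOn_const.mul
      ((hP.comp (by fun_prop) fun p hp => hp.1.2.1.1).sub
        (hP.comp (by fun_prop) fun p hp => hp.1.2.2.1)))
  have hmem : (u, r, s) ∈ D :=
    ⟨⟨hu, ⟨hs.trans hsr, by simp⟩, hs, by simp only; linarith⟩, hsr⟩
  obtain ⟨⟨u₀, r₀, s₀⟩, ⟨⟨hu₀, hr₀, hs₀⟩, hle⟩, hmax⟩ := hcomp.exists_isMaxOn ⟨_, hmem⟩ hcont
  have hpos : 0 < v u₀ r₀ - v u₀ s₀ - K * (decayPrim δ r₀ - decayPrim δ s₀) :=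
    lt_of_lt_of_le (sub_pos.2 hlt) (hmax hmem)
  simp only [mem_ofPred_eq] at hu₀ hr₀ hs₀ hle
  have hne : u₀ ≠ 0 := by
    rintro rfl
    linarith [h0 s₀ r₀ hs₀.1 hle]
  have hlt₀ : s₀ < r₀ := by
    refine lt_of_le_of_ne hle ?_
    rintro rfl
    simp at hpos
  have hcu := hc u₀ hu₀
  have hnear : 1 + r₀ ≤ 2 * (1 + s₀) := by
    by_contra! hfar
    have h1 := rpow_half_le hδ₁ (by linarith) hs₀.1 hfar.le
    have h2 := (abs_le.1 (hb u₀ hu₀ r₀ hr₀.1)).2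
    have h3 := (abs_le.1 (hb u₀ hu₀ s₀ hs₀.1)).1
    have hz : 0 < (1 + s₀) ^ (-(2 - δ)) := Real.rpow_pos_of_pos (by linarith [hs₀.1]) _
    unfold decayPrim at hpos
    set z := (1 + s₀) ^ (-(2 - δ))
    set y := (1 + r₀) ^ (-(2 - δ))
    have h4 : 1 / 2 ≤ 1 / (2 - δ) := one_div_le_one_div_of_le (by linarith) (by linarith)
    set κ := 1 / (2 - δ)
    have h5 : 1 / 2 * (z / 2) ≤ κ * (z - y) := by
      gcongr
      linarith
    have h6 : K * (1 / 2 * (z / 2)) ≤ K * (κ * (z - y)) :=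
      mul_le_mul_of_nonneg_left h5 (by linarith)
    have h7 : 116 * e * z < K * z := mul_lt_mul_of_pos_right hK hz
    have h8 : e * y ≤ e * (z / 2) := mul_le_mul_of_nonneg_left h1 he.le
    have h9 := mul_pos he hz
    linarith
  have hdu := deriv_sign_of_max (c := 1)
    (((hasDerivAt_fst hv.contDiff u₀ r₀).sub (hasDerivAt_fst hv.contDiff u₀ s₀)).sub_const
      (K * (decayPrim δ r₀ - decayPrim δ s₀))) hu₀
    (fun y hy => hmax (show (y, r₀, s₀) ∈ D from ⟨⟨hy, hr₀, hs₀⟩, hle⟩))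
    (fun h => absurd h hne) (fun _ => zero_le_one)
  have hdr := deriv_sign_of_max (c := -F u₀ r₀) (a := s₀) (b := r + 2)
    (((hasDerivAt_snd hv.contDiff u₀ r₀).sub_const (v u₀ s₀)).sub
      (((hasDerivAt_decayPrim (δ := δ) (by linarith) hr₀.1).sub_const
        (decayPrim δ s₀)).const_mul K)) ⟨hle, hr₀.2⟩
    (fun y hy => hmax (show (u₀, y, s₀) ∈ D from
      ⟨⟨hu₀, ⟨hs₀.1.trans hy.1, hy.2⟩, hs₀⟩, hy.1⟩))
    (fun h => absurd h hlt₀.ne')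
    (fun h => by have := hcu.F_nonpos r₀ (by linarith); linarith)
  have hds := deriv_sign_of_max (c := -F u₀ s₀) (a := 0) (b := r₀)
    (((hasDerivAt_snd hv.contDiff u₀ s₀).const_sub (v u₀ r₀)).sub
      (((hasDerivAt_decayPrim (δ := δ) (by linarith) hs₀.1).const_sub
        (decayPrim δ r₀)).const_mul K)) ⟨hs₀.1, hle⟩
    (fun y hy => hmax (show (u₀, r₀, y) ∈ D from
      ⟨⟨hu₀, hr₀, ⟨hy.1, hy.2.trans hr₀.2⟩⟩, hy.2⟩))
    (fun h => by rw [h, hcu.F_zero]; norm_num)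
    (fun h => absurd h hlt₀.ne)
  have heqr := hv.eqn u₀ hu₀ r₀ hr₀.1
  have heqs := hv.eqn u₀ hu₀ s₀ hs₀.1
  rw [(hasDerivAt_fst hv.contDiff u₀ r₀).deriv, (hasDerivAt_snd hv.contDiff u₀ r₀).deriv] at heqr
  rw [(hasDerivAt_fst hv.contDiff u₀ s₀).deriv, (hasDerivAt_snd hv.contDiff u₀ s₀).deriv] at heqs
  have hanti := hcu.strictAntiOn_two_point hδ₁ hδ₂ he hK hs₀.1 hnear (hb u₀ hu₀ s₀ hs₀.1)
    (left_mem_Icc.2 hle) (right_mem_Icc.2 hle) hlt₀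
  simp only at hanti
  have hG := hcu.G_nonpos r₀ hr₀.1
  have h1 : 2 * G u₀ r₀ * (v u₀ r₀ - v u₀ s₀) ≤
      2 * G u₀ r₀ * (K * (decayPrim δ r₀ - decayPrim δ s₀)) :=
    mul_le_mul_of_nonpos_left (by linarith) (by linarith)
  linarith

theorem SolvesTransport.deriv_le_of_initial (hv : SolvesTransport U F G S v)
    (hc : ∀ u ∈ Icc (0:ℝ) U, CoeffBounds δ e (F u) (G u) (S u))
    (hδ₁ : 0 < δ) (hδ₂ : δ < 1 / 2) (he : 0 < e) (hK : 116 * e < K)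
    (hb : ∀ u ∈ Icc (0:ℝ) U, ∀ r, 0 ≤ r → |v u r| ≤ e * (1 + r) ^ (-(2 - δ)))
    (h0 : ∀ r, 0 ≤ r → deriv (v 0) r ≤ K * (1 + r) ^ (-(3 - δ)))
    {u r : ℝ} (hu : u ∈ Icc 0 U) (hr : 0 ≤ r) :
    deriv (v u) r ≤ K * (1 + r) ^ (-(3 - δ)) := by
  have hd : ∀ u r, HasDerivAt (v u) (deriv (v u) r) r := fun u r =>
    (hasDerivAt_snd hv.contDiff u r).differentiableAt.hasDerivAt
  have hP : ∀ t, 0 ≤ t → HasDerivAt (decayPrim δ) ((1 + t) ^ (-(3 - δ))) t :=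
    fun t ht => hasDerivAt_decayPrim (by linarith) ht
  have h0' : ∀ s r, 0 ≤ s → s ≤ r → v 0 r - v 0 s ≤ K * (decayPrim δ r - decayPrim δ s) := by
    have hanti : AntitoneOn (v 0 - fun t => K * decayPrim δ t) (Ici 0) := by
      have hd0 : ∀ t, 0 ≤ t → HasDerivAt (v 0 - fun t => K * decayPrim δ t)
          (deriv (v 0) t - K * (1 + t) ^ (-(3 - δ))) t :=
        fun t ht => (hd 0 t).sub ((hP t ht).const_mul K)
      apply antitoneOn_of_deriv_nonpos (convex_Ici 0)
      · exact fun t ht => (hd0 t ht).continuousAt.continuousWithinAt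
      · intro t ht
        exact (hd0 t (interior_subset ht)).differentiableAt.differentiableWithinAt
      · intro t ht
        rw [(hd0 t (interior_subset ht)).deriv]
        linarith [h0 t (interior_subset ht)]
    intro s r hs hsr
    have := hanti (mem_Ici.2 hs) (mem_Ici.2 (hs.trans hsr)) hsr
    simp only [Pi.sub_apply] at this
    linarith
  have h := deriv_sign_of_max (c := -1) (a := r) (b := r + 1) (x := r)
    ((hd u r).sub ((hP r hr).const_mul K)) ⟨le_rfl, by linarith⟩
    (fun y hy => by
      have := hv.sub_le_of_initial hc hδ₁ hδ₂ he hK hb h0' hu hr hy.1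
      simp only [Pi.sub_apply]
      linarith)
    (fun _ => by norm_num) (fun h => by linarith)
  linarith

theorem SolvesTransport.abs_deriv_le_of_initial (hv : SolvesTransport U F G S v)
    (hc : ∀ u ∈ Icc (0:ℝ) U, CoeffBounds δ e (F u) (G u) (S u))
    (hδ₁ : 0 < δ) (hδ₂ : δ < 1 / 2) (he : 0 < e) (hK : 116 * e < K)
    (hb : ∀ u ∈ Icc (0:ℝ) U, ∀ r, 0 ≤ r → |v u r| ≤ e * (1 + r) ^ (-(2 - δ)))
    (h0 : ∀ r, 0 ≤ r → |deriv (v 0) r| ≤ K * (1 + r) ^ (-(3 - δ)))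
    {u r : ℝ} (hu : u ∈ Icc 0 U) (hr : 0 ≤ r) :
    |deriv (v u) r| ≤ K * (1 + r) ^ (-(3 - δ)) := by
  have hneg : ∀ u r, deriv (fun r => -v u r) r = -deriv (v u) r := fun u r => deriv.fun_neg
  rw [abs_le']
  refine ⟨hv.deriv_le_of_initial hc hδ₁ hδ₂ he hK hb (fun r hr => (abs_le'.1 (h0 r hr)).1) hu hr,
    ?_⟩
  rw [← hneg]
  refine hv.neg.deriv_le_of_initial (fun u hu => (hc u hu).neg_source) hδ₁ hδ₂ he hK
    (fun u hu r hr => by rw [abs_neg]; exact hb u hu r hr) (fun r hr => ?_) hu hr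
  rw [hneg]
  exact (abs_le'.1 (h0 r hr)).2

end Transport

theorem DecayProfile.abs_integral_le {δ e : ℝ} {w : ℝ → ℝ} (H : DecayProfile δ e w) {r : ℝ}
    (hr : 0 ≤ r) : |∫ s in (0:ℝ)..r, w s| ≤ 2 * (δ * e) := by
  have hδ := H.δ_pos
  have hδ' := H.δ_lt
  have hX : 0 < δ * e := mul_pos hδ H.e_pos
  have h : |∫ s in (0:ℝ)..r, w s| ≤ 2 * (δ * e) * (1 - (1 + r) ^ (-(1 - δ))) := by
    refine abs_le_of_hasDerivAt_abs_le
      (ψ := fun r => 2 * (δ * e) * (1 - (1 + r) ^ (-(1 - δ))))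
      (continuousOn_primitive H.cont.continuousOn)
      (continuousOn_const.mul (continuousOn_const.sub (continuousOn_one_add_rpow _)))
      (fun x hx => hasDerivAt_primitive H.cont.continuousOn hx)
      (fun x hx => ((hasDerivAt_one_add_rpow (-(1 - δ)) hx.le).const_sub 1).const_mul _)
      (fun x hx => ?_) (by simp) hr
    refine (H.bound x hx.le).trans ?_
    have hp : (1 + x) ^ (-(1 - δ)) / (1 + x) = (1 + x) ^ (-(2 - δ)) := by
      rw [← Real.rpow_sub_one (by linarith)]
      congr 1
      ring
    have hz : 0 < (1 + x) ^ (-(2 - δ)) := Real.rpow_pos_of_pos (by linarith) _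
    rw [mul_div_assoc, hp]
    nlinarith [mul_pos hX hz]
  have hz : 0 < (1 + r) ^ (-(1 - δ)) := Real.rpow_pos_of_pos (by linarith) _
  nlinarith [mul_pos hX hz]

theorem rpow_mul_le_iff {p r a x : ℝ} (hr : 0 ≤ r) :
    (1 + r) ^ p * a ≤ x ↔ a ≤ x * (1 + r) ^ (-p) := by
  have h : 0 < (1 + r) ^ p := Real.rpow_pos_of_pos (by linarith) _
  rw [Real.rpow_neg (by linarith), ← div_eq_mul_inv, le_div_iff₀ h, mul_comm]

theorem iteration_uniform_bounds (δ : ℝ) (hδ₁ : 0 < δ) (hδ₂ : δ < 1/2) :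
    ∃ x₀' > (0:ℝ), ∀ U : ℝ, 0 < U →
      ∀ (h₀ : ℝ → ℝ) (hU : ℝ → ℝ → ℝ) (w h : ℕ → ℝ → ℝ → ℝ),
        IterSetup δ U h₀ hU w h →
        wnorm (2 - δ) (deriv h₀) ≤ x₀' →
        ∃ C > (0:ℝ), ∃ x' > (0:ℝ), ∃ x'' > (0:ℝ),
          (∀ n : ℕ, 1 ≤ n → ∀ u ∈ Icc (0:ℝ) U, ∀ r : ℝ, 0 ≤ r →
            |h n u r| ≤ (⨆ u' : Icc (0:ℝ) U, |hU u'.1 0|) + C * x') ∧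
          (∀ n : ℕ, 1 ≤ n → ∀ u ∈ Icc (0:ℝ) U, ∀ r : ℝ, 0 ≤ r →
            (1 + r) ^ (2 - δ) * |w n u r| ≤ x') ∧
          (∀ n : ℕ, 1 ≤ n → ∀ u ∈ Icc (0:ℝ) U, ∀ r : ℝ, 0 ≤ r →
            (1 + r) ^ (3 - δ) * |deriv (w n u) r| ≤ x'') := by
  have hX : 6 * (δ / 10) ^ 3 < δ * (δ / 10) := by nlinarith [mul_pos hδ₁ hδ₁]
  have he : 0 < δ / 10 := by linarith
  have hx' : 0 < δ * (δ / 10) := mul_pos hδ₁ he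
  refine ⟨δ * (δ / 10), hx', fun U hU₀ h₀ hU w h hset hnorm => ?_⟩
  obtain ⟨hC2, -, hbd1, ⟨M, hM⟩, hUc, -, -, hw1, hwC, hh, hw0, heq⟩ := hset
  set e := δ / 10 with he_def
  have hinit : ∀ r, 0 ≤ r → |deriv h₀ r| ≤ δ * e * (1 + r) ^ (-(2 - δ)) := fun r hr =>
    (rpow_mul_le_iff hr).1 ((le_ciSup hbd1 ⟨r, hr⟩).trans hnorm)
  have hinit' : ∀ r, 0 ≤ r → |deriv (deriv h₀) r| ≤ M * (1 + r) ^ (-(3 - δ)) := fun r hr =>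
    (rpow_mul_le_iff hr).1 (hM ⟨⟨r, hr⟩, rfl⟩)
  have hprof : ∀ n, 1 ≤ n → ∀ u, (∀ r, 0 ≤ r → |w n u r| ≤ δ * e * (1 + r) ^ (-(2 - δ))) →
      DecayProfile δ e (w n u) := fun n hn u hb =>
    ⟨hδ₁, hδ₂, he, by linarith, continuous_iff_continuousAt.2 fun r =>
      (hasDerivAt_snd (hwC n hn) u r).continuousAt, hb⟩
  have hsolve : ∀ n, 1 ≤ n → (∀ u ∈ Icc (0:ℝ) U, DecayProfile δ e (w n u)) →
      SolvesTransport U (fun u => profFt (w n u)) (fun u => profG (w n u))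
        (fun u r => profJ (w n u) r * radQuot (w n u) r) (w (n + 1)) := fun n hn H =>
    .of_pos (hwC (n + 1) (by omega)) (fun u hu => (H u hu).coeffBounds) fun u hu r hr => by
      have h1 := heq n hn u hu r hr
      rwa [metFt_eq (H u hu) (hh n hn u) hr.le, coefG_eq (H u hu) (hh n hn u) hr.le,
        coefS_eq (H u hu) (hh n hn u) hr] at h1
  have hbound : ∀ n, 1 ≤ n → ∀ u ∈ Icc (0:ℝ) U, DecayProfile δ e (w n u) := by
    intro n hn
    induction n, hn using Nat.le_induction with
    | base => exact fun u _ => hprof 1 le_rfl u fun r hr => by rw [hw1]; exact hinit r hr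
    | succ n hn ih =>
      exact fun u hu => hprof (n + 1) (by omega) u fun r hr =>
        (hsolve n hn ih).abs_le_of_initial_le (fun u hu => (ih u hu).coeffBounds) hX he
          (fun r hr => by rw [hw0 n hn r hr]; exact hinit r hr) hu hr
  set K := max M (120 * e)
  have hK : 116 * e < K := lt_of_lt_of_le (by linarith) (le_max_right _ _)
  have hinitK : ∀ r, 0 ≤ r → |deriv (deriv h₀) r| ≤ K * (1 + r) ^ (-(3 - δ)) := fun r hr =>
    (hinit' r hr).trans
      (mul_le_mul_of_nonneg_right (le_max_left _ _) (Real.rpow_nonneg (by linarith) _))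
  refine ⟨2, two_pos, δ * e, hx', K, by linarith, fun n hn u hu r hr => ?_,
    fun n hn u hu r hr => (rpow_mul_le_iff hr).2 ((hbound n hn u hu).bound r hr),
    fun n hn u hu r hr => (rpow_mul_le_iff hr).2 ?_⟩
  · rw [hh n hn u r]
    refine (abs_add_le _ _).trans (add_le_add ?_ ((hbound n hn u hu).abs_integral_le hr))
    have hc : Continuous fun u => |hU u 0| :=
      (hUc.continuous.comp (by fun_prop : Continuous fun u : ℝ => (u, (0:ℝ)))).abs
    have hbdd : BddAbove (range fun u' : Icc (0:ℝ) U => |hU u'.1 0|) :=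
      (isCompact_range (hc.comp continuous_subtype_val)).bddAbove
    exact le_ciSup hbdd ⟨u, hu⟩
  · obtain rfl | ⟨m, hm, rfl⟩ : n = 1 ∨ ∃ m, 1 ≤ m ∧ n = m + 1 := by
      rcases Nat.lt_or_ge 1 n with h1 | h1
      · exact Or.inr ⟨n - 1, by omega, by omega⟩
      · exact Or.inl (by omega)
    · rw [show w 1 u = deriv h₀ from funext (hw1 u)]
      exact hinitK r hr
    · have hd0 : ∀ r, 0 < r → deriv (w (m + 1) 0) r = deriv (deriv h₀) r := fun r hr =>
        Filter.EventuallyEq.deriv_eq (by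
          filter_upwards [lt_mem_nhds hr] with x hx
          exact hw0 m hm x hx.le)
      have hc0 : EqOn (deriv (w (m + 1) 0)) (deriv (deriv h₀)) (Ici 0) := by
        have hc2 : Continuous (deriv (deriv h₀)) := by
          have h1 : ContDiff ℝ 1 (deriv h₀) := hC2.deriv'
          exact h1.continuous_deriv le_rfl
        exact EqOn.of_subset_closure (s := Ioi 0) (fun r hr => hd0 r hr)
          (continuous_deriv_snd (hwC (m + 1) hn) 0).continuousOn hc2.continuousOn
          Ioi_subset_Ici_self (by simp)
      refine (hsolve m hm (hbound m hm)).abs_deriv_le_of_initial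
        (fun u hu => (hbound m hm u hu).coeffBounds) hδ₁ hδ₂ he hK
        (fun u hu r hr => ((hbound (m + 1) hn u hu).bound r hr).trans ?_)
        (fun r hr => by rw [hc0 hr]; exact hinitK r hr) hu hr
      have hz : 0 < (1 + r) ^ (-(2 - δ)) := Real.rpow_pos_of_pos (by linarith) _
      refine mul_le_mul_of_nonneg_right ?_ hz.le
      nlinarith
end
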